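/- arXiv:2506.13462 — 2 statements merged into one kernel-verified Lean document; each statement's English description precedes it below -/
import Mathlib

section
/- For every ξ ∈ C_c^∞(Ω) with ξ ≥ 0 one has −∫_{ℝ^d} |u(x)| Lξ(x) dx ≤ ∫_Ω sgn(u(x)) F(x) ξ(x) dx. (Kato's inequality for the nonlocal operator L.) -/
open MeasureTheory Filter Topology Set

noncomputable section

/-- The truncated integral `∫_{|y|>r} (w(x+y) - w(x)) j(|y|) dy` approximating the
principal value defining `Lw(x)`. -/
noncomputable def truncL (d : ℕ) (j : ℝ → ℝ) (w : EuclideanSpace ℝ (Fin d) → ℝ)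
    (x : EuclideanSpace ℝ (Fin d)) (r : ℝ) : ℝ :=
  ∫ y in {y : EuclideanSpace ℝ (Fin d) | r < ‖y‖}, (w (x + y) - w x) * j ‖y‖

/-- The principal value `Lw(x) = lim_{δ↓0} ∫_{|y|>δ} (w(x+y) - w(x)) j(|y|) dy`
exists and equals `ℓ`. -/
def HasPVLim (d : ℕ) (j : ℝ → ℝ) (w : EuclideanSpace ℝ (Fin d) → ℝ)
    (x : EuclideanSpace ℝ (Fin d)) (ℓ : ℝ) : Prop :=
  Tendsto (truncL d j w x) (𝓝[>] (0:ℝ)) (𝓝 ℓ)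

/-- `ξ ∈ C_c^∞(Ω)`. -/
def IsTestOn (d : ℕ) (Ω : Set (EuclideanSpace ℝ (Fin d)))
    (ξ : EuclideanSpace ℝ (Fin d) → ℝ) : Prop :=
  ContDiff ℝ (⊤ : ℕ∞) ξ ∧ HasCompactSupport ξ ∧ tsupport ξ ⊆ Ω

/-- Bundled hypotheses on the jump kernel. -/
structure JHyp (d : ℕ) (j : ℝ → ℝ) (κ : ℝ) : Prop where
  pos : ∀ r > 0, 0 < j r
  anti : AntitoneOn j (Set.Ioi 0)
  int : Integrable (fun y : EuclideanSpace ℝ (Fin d) => min 1 (‖y‖ ^ 2) * j ‖y‖)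
  one_le : 1 ≤ κ
  doub : ∀ r > 0, j r ≤ κ * j (2 * r)

/-- truncated kernel -/
def jker (d : ℕ) (j : ℝ → ℝ) (δ : ℝ) : EuclideanSpace ℝ (Fin d) → ℝ :=
  indicator {y | δ < ‖y‖} (fun y => j ‖y‖)

/-- convolution -/
def cv {d : ℕ} (K f : EuclideanSpace ℝ (Fin d) → ℝ) (x : EuclideanSpace ℝ (Fin d)) : ℝ :=
  ∫ y, K (x - y) * f y

/-- weight -/
def wt (d : ℕ) (j : ℝ → ℝ) (x : EuclideanSpace ℝ (Fin d)) : ℝ := j (1 + ‖x‖)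

section basic
variable {d : ℕ} {j : ℝ → ℝ} {κ : ℝ}

lemma JHyp.meas_max (h : JHyp d j κ) {δ : ℝ} (hδ : 0 < δ) : Measurable (fun r => j (max r δ)) := by
  apply Antitone.measurable
  intro a b hab
  exact h.anti (lt_of_lt_of_le hδ (le_max_right _ _)) (lt_of_lt_of_le hδ (le_max_right _ _))
    (max_le_max hab le_rfl)

lemma JHyp.wt_meas (h : JHyp d j κ) : Measurable (wt d j) := by
  have : wt d j = fun x => (fun r => j (max r 1)) (1 + ‖x‖) := by
    funext x
    simp [wt]
  rw [this]
  exact (h.meas_max one_pos).comp (by fun_prop)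

lemma one_add_pos' (x : EuclideanSpace ℝ (Fin d)) : 0 < 1 + ‖x‖ := by positivity

lemma JHyp.wt_pos (h : JHyp d j κ) (x) : 0 < wt d j x := h.pos _ (one_add_pos' x)

lemma JHyp.wt_le (h : JHyp d j κ) (x) : wt d j x ≤ j 1 :=
  h.anti (by simp) (one_add_pos' x) (by simp)

lemma JHyp.wt_harnack (h : JHyp d j κ) (x y : EuclideanSpace ℝ (Fin d)) (hxy : ‖x - y‖ ≤ 1) :
    wt d j y ≤ κ * wt d j x := by
  refine (h.doub _ (one_add_pos' y)).trans ?_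
  refine mul_le_mul_of_nonneg_left ?_ (by linarith [h.one_le])
  refine h.anti (one_add_pos' x) (by have := one_add_pos' y; simp; positivity) ?_
  have := norm_add_le (x - y) y
  simp at this
  linarith [norm_nonneg y]

lemma JHyp.wt_lower (h : JHyp d j κ) {R : ℝ} (hR : 0 ≤ R) (x : EuclideanSpace ℝ (Fin d))
    (hx : ‖x‖ ≤ R) : j (1 + R) ≤ wt d j x :=
  h.anti (one_add_pos' x) (by simp; positivity) (by linarith)

lemma jker_even (δ : ℝ) (y) : jker d j δ (-y) = jker d j δ y := by
  simp [jker, indicator]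

lemma JHyp.jker_nonneg (h : JHyp d j κ) {δ : ℝ} (hδ : 0 < δ) (y) : 0 ≤ jker d j δ y := by
  unfold jker
  apply indicator_nonneg
  intro y hy
  exact (h.pos _ (hδ.trans hy)).le

lemma measSet (δ : ℝ) : MeasurableSet {y : EuclideanSpace ℝ (Fin d) | δ < ‖y‖} :=
  measurableSet_lt measurable_const measurable_norm

lemma JHyp.jker_meas (h : JHyp d j κ) {δ : ℝ} (hδ : 0 < δ) : Measurable (jker d j δ) := by
  have : jker d j δ = indicator {y | δ < ‖y‖} (fun y => (fun r => j (max r δ)) ‖y‖) := by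
    unfold jker
    apply indicator_congr
    intro y hy
    simp only [mem_ofPred_eq] at hy
    simp [max_eq_left hy.le]
  rw [this]
  exact ((h.meas_max hδ).comp measurable_norm).indicator (measSet δ)

lemma JHyp.jker_int (h : JHyp d j κ) {δ : ℝ} (hδ : 0 < δ) : Integrable (jker d j δ) := by
  have hc : 0 < min 1 (δ ^ 2) := by positivity
  refine (h.int.const_mul (min 1 (δ ^ 2))⁻¹).mono' (h.jker_meas hδ).aestronglyMeasurable ?_
  rcases Nat.eq_zero_or_pos d with hd | hd
  · subst hd
    filter_upwards with y
    have : y = 0 := Subsingleton.elim _ _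
    subst this
    simp [jker, hδ.le]
  have : Nonempty (Fin d) := ⟨⟨0, hd⟩⟩
  have : ∀ᵐ y : EuclideanSpace ℝ (Fin d), y ≠ 0 := by
    simp [ae_iff]
  filter_upwards [this] with y hy
  have hy' : 0 < ‖y‖ := norm_pos_iff.mpr hy
  have hj := h.pos _ hy'
  rw [Real.norm_of_nonneg (h.jker_nonneg hδ y)]
  unfold jker indicator
  split_ifs with hh
  · simp only [mem_ofPred_eq] at hh
    rw [← mul_assoc]
    refine le_mul_of_one_le_left hj.le ?_
    rw [← div_eq_inv_mul, one_le_div hc]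
    exact min_le_min le_rfl (by gcongr)
  · positivity

lemma JHyp.jker_le (h : JHyp d j κ) {δ : ℝ} (hδ : 0 < δ) (x y : EuclideanSpace ℝ (Fin d))
    {R : ℝ} (hy : ‖y‖ ≤ R) (hx : 2 * R + 1 ≤ ‖x‖) : jker d j δ (x - y) ≤ κ * wt d j x := by
  unfold jker indicator
  split_ifs with hh
  · simp only [mem_ofPred_eq] at hh
    have h1 := norm_sub_norm_le x y
    have h0 := one_add_pos' x
    have h2 : (1 + ‖x‖) / 2 ≤ ‖x - y‖ := by linarith
    have h3 := h.anti (show (0:ℝ) < (1 + ‖x‖) / 2 by linarith) (hδ.trans hh) h2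
    refine h3.trans ((h.doub _ (by linarith)).trans_eq ?_)
    unfold wt
    congr 2
    ring
  · have := h.wt_pos x
    have := h.one_le
    positivity

end basic
section second
variable {d : ℕ} {j : ℝ → ℝ} {κ : ℝ}

lemma truncL_eq_ker (w : EuclideanSpace ℝ (Fin d) → ℝ) (x) (δ : ℝ) :
    truncL d j w x δ = ∫ y, (w (x + y) - w x) * jker d j δ y := by
  unfold truncL
  rw [← integral_indicator (measSet δ)]
  congr 1
  funext y
  unfold jker indicator
  split_ifs <;> simp

lemma supp_bound {ψ : EuclideanSpace ℝ (Fin d) → ℝ} (hs : HasCompactSupport ψ) :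
    ∃ R : ℝ, 0 ≤ R ∧ ∀ x, R < ‖x‖ → ψ x = 0 := by
  obtain ⟨R, hR⟩ := hs.isCompact.isBounded.exists_norm_le
  refine ⟨max R 0, le_max_right _ _, fun x hx => ?_⟩
  by_contra hne
  have := hR x (subset_tsupport _ hne)
  exact absurd hx (not_lt.mpr (this.trans (le_max_left _ _)))

lemma val_bound {ψ : EuclideanSpace ℝ (Fin d) → ℝ} (hc : Continuous ψ)
    (hs : HasCompactSupport ψ) : ∃ M : ℝ, 0 ≤ M ∧ ∀ x, |ψ x| ≤ M := by
  obtain ⟨C, hC⟩ := hs.exists_bound_of_continuous hc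
  exact ⟨C, (norm_nonneg _).trans (hC 0), hC⟩

lemma JHyp.jker_conv_int (h : JHyp d j κ) {δ : ℝ} (hδ : 0 < δ)
    {ψ : EuclideanSpace ℝ (Fin d) → ℝ} (hc : Continuous ψ)
    (hs : HasCompactSupport ψ) (x) : Integrable (fun y => jker d j δ (x - y) * ψ y) := by
  obtain ⟨M, hM0, hM⟩ := val_bound hc hs
  exact ((h.jker_int hδ).comp_sub_left x).mul_bdd (c := M) hc.aestronglyMeasurable (by
    filter_upwards with y using hM y)

lemma JHyp.truncL_eq (h : JHyp d j κ) {δ : ℝ} (hδ : 0 < δ)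
    {ψ : EuclideanSpace ℝ (Fin d) → ℝ} (hc : Continuous ψ)
    (hs : HasCompactSupport ψ) (x) :
    truncL d j ψ x δ = cv (jker d j δ) ψ x - (∫ y, jker d j δ y) * ψ x := by
  rw [truncL_eq_ker]
  have e1 : (fun y => (ψ (x + y) - ψ x) * jker d j δ y) = fun y =>
      (fun z => jker d j δ (x - z) * ψ z) (x + y) - jker d j δ y * ψ x := by
    funext y
    have : x - (x + y) = - y := by abel
    simp only [this, jker_even]
    ring
  rw [e1, integral_sub ((h.jker_conv_int hδ hc hs x).comp_add_left x)
    ((h.jker_int hδ).mul_const _),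
    integral_add_left_eq_self (fun z => jker d j δ (x - z) * ψ z) x, integral_mul_const]
  rfl

lemma JHyp.cv_far (h : JHyp d j κ) {δ : ℝ} (hδ : 0 < δ)
    {ψ : EuclideanSpace ℝ (Fin d) → ℝ} (hc : Continuous ψ)
    (hs : HasCompactSupport ψ) {R : ℝ} (hR : ∀ x, R < ‖x‖ → ψ x = 0) (x)
    (hx : 2 * R + 1 ≤ ‖x‖) :
    cv (jker d j δ) (fun y => |ψ y|) x ≤ (κ * ∫ y, |ψ y|) * wt d j x := by
  unfold cv
  have : (κ * ∫ y, |ψ y|) * wt d j x = ∫ y, (κ * wt d j x) * |ψ y| := by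
    rw [integral_const_mul]; ring
  rw [this]
  have hs' : HasCompactSupport (fun y => |ψ y|) := hs.comp_left abs_zero
  refine integral_mono (h.jker_conv_int hδ hc.abs hs' x)
    ((hc.abs.integrable_of_hasCompactSupport hs').const_mul _) (fun y => ?_)
  by_cases hy : ‖y‖ ≤ R
  · exact mul_le_mul_of_nonneg_right (h.jker_le hδ x y hy hx) (abs_nonneg _)
  · simp [hR y (not_le.mp hy)]

lemma JHyp.bound_glue (h : JHyp d j κ) {R A B : ℝ} (hR : 0 ≤ R) (hA : 0 ≤ A) (hB : 0 ≤ B)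
    (f : EuclideanSpace ℝ (Fin d) → ℝ) (x) (h1 : f x ≤ B)
    (h2 : 2 * R + 1 ≤ ‖x‖ → f x ≤ A * wt d j x) :
    f x ≤ (A + B / j (1 + (2 * R + 1))) * wt d j x := by
  have hp := h.wt_pos x
  have hj := h.pos (1 + (2 * R + 1)) (by positivity)
  by_cases hx : 2 * R + 1 ≤ ‖x‖
  · refine (h2 hx).trans ?_
    gcongr
    have : 0 ≤ B / j (1 + (2 * R + 1)) := by positivity
    linarith
  · have h3 := h.wt_lower (show 0 ≤ 2 * R + 1 by positivity) x (not_le.mp hx).le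
    calc f x ≤ B := h1
      _ = B / j (1 + (2 * R + 1)) * j (1 + (2 * R + 1)) := by field_simp
      _ ≤ B / j (1 + (2 * R + 1)) * wt d j x := by gcongr
      _ ≤ _ := by
        gcongr
        linarith

lemma JHyp.cv_bound (h : JHyp d j κ) {δ : ℝ} (hδ : 0 < δ)
    {ψ : EuclideanSpace ℝ (Fin d) → ℝ} (hc : Continuous ψ)
    (hs : HasCompactSupport ψ) :
    ∃ C : ℝ, 0 ≤ C ∧ ∀ x, cv (jker d j δ) (fun y => |ψ y|) x ≤ C * wt d j x := by
  obtain ⟨M, hM0, hM⟩ := val_bound hc hs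
  obtain ⟨R, hR0, hR⟩ := supp_bound hs
  have hk0 : 0 ≤ ∫ y, jker d j δ y := integral_nonneg (h.jker_nonneg hδ)
  have hp0 : 0 ≤ ∫ y, |ψ y| := integral_nonneg (fun _ => abs_nonneg _)
  have hκ : 0 ≤ κ := by linarith [h.one_le]
  have hj := h.pos (1 + (2 * R + 1)) (by positivity)
  refine ⟨κ * (∫ y, |ψ y|) + ((∫ y, jker d j δ y) * M) / j (1 + (2 * R + 1)), by positivity,
    fun x => ?_⟩
  refine h.bound_glue hR0 (by positivity) (by positivity) _ x ?_ (h.cv_far hδ hc hs hR x)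
  unfold cv
  rw [← integral_mul_const, ← integral_sub_left_eq_self (fun y => jker d j δ y * M) volume x]
  refine integral_mono (h.jker_conv_int hδ hc.abs (hs.comp_left abs_zero) x)
    (((h.jker_int hδ).mul_const M).comp_sub_left x) (fun y => ?_)
  exact mul_le_mul_of_nonneg_left (hM y) (h.jker_nonneg hδ _)

lemma second_diff {ψ : EuclideanSpace ℝ (Fin d) → ℝ} (hc : ContDiff ℝ (⊤ : ℕ∞) ψ)
    (hs : HasCompactSupport ψ) :
    ∃ C : ℝ, 0 ≤ C ∧ ∀ x y, |ψ (x + y) + ψ (x - y) - 2 * ψ x| ≤ C * min 1 (‖y‖ ^ 2) := by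
  obtain ⟨M, hM0, hM⟩ := val_bound hc.continuous hs
  have hd1 : ContDiff ℝ 1 (fderiv ℝ ψ) := hc.fderiv_right (by norm_cast)
  obtain ⟨K, hK⟩ := hd1.lipschitzWith_of_hasCompactSupport (hs.fderiv ℝ) (by simp)
  have hdiff : Differentiable ℝ ψ := hc.differentiable (by simp)
  refine ⟨max (4 * M) (2 * K), by positivity, fun x y => ?_⟩
  have b1 : |ψ (x + y) + ψ (x - y) - 2 * ψ x| ≤ 4 * M := by
    have h1 := abs_le.mp (hM (x + y))
    have h2 := abs_le.mp (hM (x - y))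
    have h3 := abs_le.mp (hM x)
    rw [abs_le]
    constructor <;> linarith
  have b2 : |ψ (x + y) + ψ (x - y) - 2 * ψ x| ≤ 2 * K * ‖y‖ ^ 2 := by
    have hder : ∀ z, HasFDerivAt (fun z => ψ (x + z) + ψ (x - z))
        (fderiv ℝ ψ (x + z) - fderiv ℝ ψ (x - z)) z := by
      intro z
      have h1 : HasFDerivAt (fun z => ψ (x + z)) (fderiv ℝ ψ (x + z)) z := by
        have := (hdiff (x + z)).hasFDerivAt.comp z ((hasFDerivAt_id z).const_add x)
        simpa [Function.comp_def] using this
      have h2 : HasFDerivAt (fun z => ψ (x - z)) (-fderiv ℝ ψ (x - z)) z := by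
        have := (hdiff (x - z)).hasFDerivAt.comp z ((hasFDerivAt_id z).const_sub x)
        convert! this using 1
        ext v
        simp
      rw [sub_eq_add_neg]
      exact h1.add h2
    have := (convex_closedBall (0 : EuclideanSpace ℝ (Fin d)) ‖y‖).norm_image_sub_le_of_norm_fderiv_le
      (𝕜 := ℝ) (f := fun z => ψ (x + z) + ψ (x - z)) (C := 2 * K * ‖y‖)
      (x := 0) (y := y) (fun z _ => (hder z).differentiableAt) (fun z hz => by
        rw [(hder z).fderiv, ← dist_eq_norm]
        refine (hK.dist_le_mul _ _).trans ?_
        have : dist (x + z) (x - z) ≤ 2 * ‖y‖ := by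
          rw [dist_eq_norm]
          have e : x + z - (x - z) = (2:ℝ) • z := by rw [two_smul]; abel
          rw [e, norm_smul]
          simp at hz ⊢
          exact hz
        calc (K:ℝ) * dist (x + z) (x - z) ≤ K * (2 * ‖y‖) := by gcongr
          _ = _ := by ring) (by simp) (by simp)
    simp only [add_zero, sub_zero, Real.norm_eq_abs] at this
    calc _ = |ψ (x + y) + ψ (x - y) - (ψ x + ψ x)| := by rw [two_mul]
      _ ≤ _ := this
      _ = _ := by ring
  rcases min_cases 1 (‖y‖ ^ 2) with ⟨h1, _⟩ | ⟨h1, _⟩ <;> rw [h1]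
  · rw [mul_one]; exact b1.trans (le_max_left _ _)
  · exact b2.trans (by gcongr; exact le_max_right _ _)

lemma ae_ne_zero (hd : 2 ≤ d) : ∀ᵐ y : EuclideanSpace ℝ (Fin d), y ≠ 0 := by
  have : Nonempty (Fin d) := ⟨⟨0, by omega⟩⟩
  simp [ae_iff]

lemma JHyp.truncL_sym (h : JHyp d j κ) {δ : ℝ} (hδ : 0 < δ)
    {ψ : EuclideanSpace ℝ (Fin d) → ℝ} (hc : Continuous ψ)
    (hs : HasCompactSupport ψ) (x) :
    truncL d j ψ x δ = (1/2) * ∫ y, (ψ (x + y) + ψ (x - y) - 2 * ψ x) * jker d j δ y := by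
  obtain ⟨M, hM0, hM⟩ := val_bound hc hs
  have i1 : Integrable (fun y => (ψ (x + y) - ψ x) * jker d j δ y) := by
    refine (h.jker_int hδ).bdd_mul (c := 2 * M)
      (Continuous.aestronglyMeasurable (by fun_prop)) ?_
    filter_upwards with y
    have h1 := abs_le.mp (hM (x + y))
    have h3 := abs_le.mp (hM x)
    rw [Real.norm_eq_abs, abs_le]
    constructor <;> linarith
  have e2 : truncL d j ψ x δ = ∫ y, (ψ (x - y) - ψ x) * jker d j δ y := by
    rw [truncL_eq_ker, ← integral_neg_eq_self]
    simp only [jker_even, sub_eq_add_neg]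
  have i2 : Integrable (fun y => (ψ (x - y) - ψ x) * jker d j δ y) := by
    have := i1.comp_neg
    simpa only [jker_even, sub_eq_add_neg] using this
  have e3 : truncL d j ψ x δ + truncL d j ψ x δ =
      ∫ y, (ψ (x + y) + ψ (x - y) - 2 * ψ x) * jker d j δ y := by
    nth_rewrite 1 [truncL_eq_ker]
    rw [e2, ← integral_add i1 i2]
    congr 1
    funext y
    ring
  rw [← e3]; ring

lemma JHyp.dom (hd : 2 ≤ d) (h : JHyp d j κ)
    {ψ : EuclideanSpace ℝ (Fin d) → ℝ} {C : ℝ} (hC0 : 0 ≤ C)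
    (hC : ∀ x y, |ψ (x + y) + ψ (x - y) - 2 * ψ x| ≤ C * min 1 (‖y‖ ^ 2)) (x) :
    ∀ᵐ y, ∀ δ > 0, ‖(ψ (x + y) + ψ (x - y) - 2 * ψ x) * jker d j δ y‖ ≤
      C * (min 1 (‖y‖ ^ 2) * j ‖y‖) := by
  filter_upwards [ae_ne_zero hd] with y hy δ hδ
  have hj := h.pos _ (norm_pos_iff.mpr hy)
  rw [norm_mul, ← mul_assoc]
  refine mul_le_mul (hC x y) ?_ (norm_nonneg _) (by positivity)
  rw [Real.norm_of_nonneg (h.jker_nonneg hδ y)]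
  unfold jker indicator
  split_ifs
  · exact le_rfl
  · exact hj.le

lemma JHyp.truncL_bound (hd : 2 ≤ d) (h : JHyp d j κ)
    {ψ : EuclideanSpace ℝ (Fin d) → ℝ} (hc : ContDiff ℝ (⊤ : ℕ∞) ψ)
    (hs : HasCompactSupport ψ) :
    ∃ C : ℝ, 0 ≤ C ∧ ∀ δ > 0, ∀ x, |truncL d j ψ x δ| ≤ C * wt d j x := by
  obtain ⟨D, hD0, hD⟩ := second_diff hc hs
  obtain ⟨R, hR0, hR⟩ := supp_bound hs
  have hI : 0 ≤ ∫ y : EuclideanSpace ℝ (Fin d), D * (min 1 (‖y‖ ^ 2) * j ‖y‖) := by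
    apply integral_nonneg_of_ae
    filter_upwards [ae_ne_zero hd] with y hy
    have hj := h.pos _ (norm_pos_iff.mpr hy)
    simp only [Pi.zero_apply]
    positivity
  have hp0 : 0 ≤ ∫ y, |ψ y| := integral_nonneg (fun _ => abs_nonneg _)
  have hκ : 0 ≤ κ := by linarith [h.one_le]
  have hj := h.pos (1 + (2 * R + 1)) (by positivity)
  refine ⟨κ * (∫ y, |ψ y|) + (∫ y : EuclideanSpace ℝ (Fin d), D * (min 1 (‖y‖ ^ 2) * j ‖y‖))
    / j (1 + (2 * R + 1)), by positivity,
    fun δ hδ x => ?_⟩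
  refine h.bound_glue hR0 (by positivity) (by positivity) (fun x => |truncL d j ψ x δ|) x ?_ ?_
  · rw [h.truncL_sym hδ hc.continuous hs, abs_mul]
    have := norm_integral_le_of_norm_le (h.int.const_mul D)
      ((h.dom hd hD0 hD x).mono fun y hy => hy δ hδ)
    rw [Real.norm_eq_abs] at this
    rw [show |(1/2 : ℝ)| = 1/2 by norm_num]
    linarith
  · intro hx
    refine le_trans ?_ (h.cv_far hδ hc.continuous hs hR x hx)
    rw [h.truncL_eq hδ hc.continuous hs, hR x (by linarith), mul_zero, sub_zero]
    unfold cv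
    refine (abs_integral_le_integral_abs).trans_eq ?_
    simp_rw [abs_mul, abs_of_nonneg (h.jker_nonneg hδ _)]

lemma JHyp.exists_lim (hd : 2 ≤ d) (h : JHyp d j κ)
    {ψ : EuclideanSpace ℝ (Fin d) → ℝ} (hc : ContDiff ℝ (⊤ : ℕ∞) ψ)
    (hs : HasCompactSupport ψ) : ∃ Lψ : EuclideanSpace ℝ (Fin d) → ℝ,
      ∀ x, HasPVLim d j ψ x (Lψ x) := by
  obtain ⟨D, hD0, hD⟩ := second_diff hc hs
  refine ⟨fun x => (1/2) * ∫ y, (ψ (x + y) + ψ (x - y) - 2 * ψ x) * j ‖y‖, fun x => ?_⟩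
  unfold HasPVLim
  have hcont := hc.continuous
  have : Tendsto (fun δ => (1/2) * ∫ y, (ψ (x + y) + ψ (x - y) - 2 * ψ x) * jker d j δ y)
      (𝓝[>] 0) (𝓝 ((1/2) * ∫ y, (ψ (x + y) + ψ (x - y) - 2 * ψ x) * j ‖y‖)) := by
    apply Tendsto.const_mul
    apply tendsto_integral_filter_of_dominated_convergence _ _ _ (h.int.const_mul D)
    · filter_upwards [ae_ne_zero hd] with y hy
      apply tendsto_const_nhds.congr'
      have : ∀ᶠ δ in 𝓝[>] (0:ℝ), δ < ‖y‖ :=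
        nhdsWithin_le_nhds (Iio_mem_nhds (norm_pos_iff.mpr hy))
      filter_upwards [this] with δ hδ
      simp [jker, indicator, hδ]
    · filter_upwards [self_mem_nhdsWithin] with δ hδ
      exact (Continuous.aestronglyMeasurable (by fun_prop)).mul
        (h.jker_meas hδ).aestronglyMeasurable
    · filter_upwards [self_mem_nhdsWithin] with δ hδ
      exact (h.dom hd hD0 hD x).mono fun y hy => hy δ hδ
  refine this.congr' ?_
  filter_upwards [self_mem_nhdsWithin] with δ hδ
  rw [h.truncL_sym hδ hcont hs]

end second
section third
variable {d : ℕ} {j : ℝ → ℝ} {κ : ℝ}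

lemma JHyp.pair_int (h : JHyp d j κ) {K f g : EuclideanSpace ℝ (Fin d) → ℝ}
    (hKm : Measurable K) (hK0 : ∀ x, 0 ≤ K x) (hf : AEStronglyMeasurable f)
    (hg : AEStronglyMeasurable g) (hKg : ∀ x, Integrable (fun y => K (x - y) * g y)) {C : ℝ}
    (hb : ∀ x, cv K (fun y => |g y|) x ≤ C * wt d j x)
    (hfw : Integrable (fun x => f x * wt d j x)) :
    Integrable (fun p : EuclideanSpace ℝ (Fin d) × EuclideanSpace ℝ (Fin d) =>
      f p.1 * (K (p.1 - p.2) * g p.2)) (volume.prod volume) := by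
  have hm : AEStronglyMeasurable (fun p : EuclideanSpace ℝ (Fin d) × EuclideanSpace ℝ (Fin d) =>
      f p.1 * (K (p.1 - p.2) * g p.2)) (volume.prod volume) := by
    refine hf.comp_fst.mul (AEStronglyMeasurable.mul ?_ hg.comp_snd)
    exact (hKm.comp (measurable_fst.sub measurable_snd)).aestronglyMeasurable
  rw [integrable_prod_iff hm]
  refine ⟨Eventually.of_forall fun x => (hKg x).const_mul (f x), ?_⟩
  refine (hfw.norm.const_mul C).mono' hm.norm.integral_prod_right' ?_
  filter_upwards with x
  rw [Real.norm_of_nonneg (integral_nonneg fun _ => norm_nonneg _)]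
  have : ∀ y, ‖f x * (K (x - y) * g y)‖ = |f x| * (K (x - y) * |g y|) := by
    intro y
    rw [norm_mul, norm_mul, Real.norm_of_nonneg (hK0 _)]
    rfl
  simp_rw [this]
  rw [integral_const_mul]
  calc |f x| * cv K (fun y => |g y|) x ≤ |f x| * (C * wt d j x) := by
        gcongr
        exact hb x
    _ = C * ‖f x * wt d j x‖ := by
        rw [norm_mul, Real.norm_of_nonneg (h.wt_pos x).le, Real.norm_eq_abs]; ring

lemma sym_pair {K f g : EuclideanSpace ℝ (Fin d) → ℝ} (hK : ∀ x, K (-x) = K x)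
    (hi : Integrable (fun p : EuclideanSpace ℝ (Fin d) × EuclideanSpace ℝ (Fin d) =>
      f p.1 * (K (p.1 - p.2) * g p.2)) (volume.prod volume)) :
    ∫ x, f x * cv K g x = ∫ y, g y * cv K f y := by
  have e1 : ∀ x, f x * cv K g x = ∫ y, f x * (K (x - y) * g y) := fun x => by
    rw [integral_const_mul]; rfl
  have e2 : ∀ y, g y * cv K f y = ∫ x, f x * (K (x - y) * g y) := fun y => by
    unfold cv
    rw [← integral_const_mul]
    congr 1
    funext x
    rw [← hK (y - x), neg_sub]
    ring
  simp_rw [e1, e2]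
  exact integral_integral_swap hi

lemma pair_int_left {K f g : EuclideanSpace ℝ (Fin d) → ℝ}
    (hi : Integrable (fun p : EuclideanSpace ℝ (Fin d) × EuclideanSpace ℝ (Fin d) =>
      f p.1 * (K (p.1 - p.2) * g p.2)) (volume.prod volume)) :
    Integrable (fun x => f x * cv K g x) := by
  have := hi.integral_prod_left
  refine this.congr (Eventually.of_forall fun x => ?_)
  simp only
  rw [integral_const_mul]; rfl

lemma pair_int_right {K f g : EuclideanSpace ℝ (Fin d) → ℝ} (hK : ∀ x, K (-x) = K x)
    (hi : Integrable (fun p : EuclideanSpace ℝ (Fin d) × EuclideanSpace ℝ (Fin d) =>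
      f p.1 * (K (p.1 - p.2) * g p.2)) (volume.prod volume)) :
    Integrable (fun y => g y * cv K f y) := by
  have := hi.integral_prod_right
  refine this.congr (Eventually.of_forall fun y => ?_)
  simp only
  unfold cv
  rw [← integral_const_mul]
  congr 1
  funext x
  rw [← hK (y - x), neg_sub]
  ring

lemma pair_int_ae {K f g : EuclideanSpace ℝ (Fin d) → ℝ} (hK : ∀ x, K (-x) = K x)
    (hi : Integrable (fun p : EuclideanSpace ℝ (Fin d) × EuclideanSpace ℝ (Fin d) =>
      f p.1 * (K (p.1 - p.2) * g p.2)) (volume.prod volume)) :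
    ∀ᵐ y, g y ≠ 0 → Integrable (fun x => K (y - x) * f x) := by
  filter_upwards [hi.prod_left_ae] with y hy hg
  refine (hy.const_mul (g y)⁻¹).congr (Eventually.of_forall fun x => ?_)
  simp only
  rw [← hK (y - x), neg_sub]
  field_simp

/-- the convexity step -/
lemma JHyp.convex_step (h : JHyp d j κ) {δ : ℝ} (hδ : 0 < δ)
    {φ φ' : ℝ → ℝ} (hφc : Continuous φ) (hφ'c : Continuous φ')
    (hφb : ∀ t, |φ t| ≤ |t|) (hconv : ∀ a b, φ' a * (b - a) ≤ φ b - φ a)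
    {v ξ : EuclideanSpace ℝ (Fin d) → ℝ} (hv : Continuous v)
    (hvw : Integrable (fun x => v x * wt d j x))
    (hξ : Continuous ξ) (hξs : HasCompactSupport ξ) (hξ0 : ∀ x, 0 ≤ ξ x) :
    ∫ x, v x * truncL d j (fun x => φ' (v x) * ξ x) x δ ≤ ∫ x, φ (v x) * truncL d j ξ x δ := by
  set ψ : EuclideanSpace ℝ (Fin d) → ℝ := fun x => φ' (v x) * ξ x with hψ
  have hψc : Continuous ψ := by fun_prop
  have hψs : HasCompactSupport ψ := hξs.mul_left
  set m := ∫ y, jker d j δ y with hm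
  have hfw : Integrable (fun x => φ (v x) * wt d j x) := by
    refine hvw.mono ((hφc.comp hv).aestronglyMeasurable.mul h.wt_meas.aestronglyMeasurable) ?_
    filter_upwards with x
    rw [norm_mul, norm_mul]
    gcongr
    exact hφb _
  obtain ⟨C1, -, hC1⟩ := h.cv_bound hδ hξ hξs
  obtain ⟨C2, -, hC2⟩ := h.cv_bound hδ hψc hψs
  have P1 := h.pair_int (h.jker_meas hδ) (h.jker_nonneg hδ) (hφc.comp hv).aestronglyMeasurable
    hξ.aestronglyMeasurable (h.jker_conv_int hδ hξ hξs) hC1 hfw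
  have P2 := h.pair_int (h.jker_meas hδ) (h.jker_nonneg hδ) hv.aestronglyMeasurable
    hψc.aestronglyMeasurable (h.jker_conv_int hδ hψc hψs) hC2 hvw
  have P3 := h.pair_int (h.jker_meas hδ) (h.jker_nonneg hδ) hv.aestronglyMeasurable
    hξ.aestronglyMeasurable (h.jker_conv_int hδ hξ hξs) hC1 hvw
  have Q1 : Integrable (fun x => ξ x * φ (v x)) :=
    (by fun_prop : Continuous (fun x => ξ x * φ (v x))).integrable_of_hasCompactSupport
      hξs.mul_right
  have Q2 : Integrable (fun x => ψ x * v x) :=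
    (by fun_prop : Continuous (fun x => ψ x * v x)).integrable_of_hasCompactSupport
      hψs.mul_right
  have E1 : ∫ x, φ (v x) * truncL d j ξ x δ =
      ∫ x, (ξ x * cv (jker d j δ) (φ ∘ v) x - m * (ξ x * φ (v x))) := by
    have := sym_pair (jker_even δ) P1
    rw [integral_sub (pair_int_right (jker_even δ) P1) (Q1.const_mul m), ← this,
      ← integral_sub (pair_int_left P1) (Q1.const_mul m)]
    congr 1
    funext x
    rw [h.truncL_eq hδ hξ hξs]
    simp only [Function.comp]
    ring
  have E2 : ∫ x, v x * truncL d j ψ x δ =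
      ∫ x, (ψ x * cv (jker d j δ) v x - m * (ψ x * v x)) := by
    have := sym_pair (jker_even δ) P2
    rw [integral_sub (pair_int_right (jker_even δ) P2) (Q2.const_mul m), ← this,
      ← integral_sub (pair_int_left P2) (Q2.const_mul m)]
    congr 1
    funext x
    rw [h.truncL_eq hδ hψc hψs]
    ring
  rw [E1, E2]
  refine integral_mono_ae ((pair_int_right (jker_even δ) P2).sub (Q2.const_mul m))
    ((pair_int_right (jker_even δ) P1).sub (Q1.const_mul m)) ?_
  filter_upwards [pair_int_ae (jker_even δ) P1, pair_int_ae (jker_even δ) P3] with x h1 h3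
  by_cases hx : ξ x = 0
  · simp [hψ, hx]
  have i1 := h1 hx
  have i3 := h3 hx
  have ik : Integrable (fun y => jker d j δ (x - y)) := (h.jker_int hδ).comp_sub_left x
  have hmx : ∫ y, jker d j δ (x - y) = m := integral_sub_left_eq_self _ _ _
  have key : φ' (v x) * (cv (jker d j δ) v x - m * v x) ≤
      cv (jker d j δ) (φ ∘ v) x - m * φ (v x) := by
    have a1 : cv (jker d j δ) (φ ∘ v) x - m * φ (v x) =
        ∫ y, (jker d j δ (x - y) * (φ ∘ v) y - jker d j δ (x - y) * φ (v x)) := by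
      rw [integral_sub i1 (ik.mul_const _), integral_mul_const, hmx]; rfl
    have a2 : φ' (v x) * (cv (jker d j δ) v x - m * v x) =
        ∫ y, φ' (v x) * (jker d j δ (x - y) * v y - jker d j δ (x - y) * v x) := by
      rw [integral_const_mul, integral_sub i3 (ik.mul_const _), integral_mul_const, hmx]; rfl
    rw [a1, a2]
    refine integral_mono ((i3.sub (ik.mul_const _)).const_mul _) (i1.sub (ik.mul_const _))
      (fun y => ?_)
    have := mul_le_mul_of_nonneg_left (hconv (v x) (v y)) (h.jker_nonneg hδ (x - y))
    simp only [Function.comp]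
    linarith
  have := mul_le_mul_of_nonneg_left key (hξ0 x)
  simp only [hψ]
  linarith

section bump
variable (b : ContDiffBump (0 : EuclideanSpace ℝ (Fin d)))

/-- mollifier -/
abbrev rho (b : ContDiffBump (0 : EuclideanSpace ℝ (Fin d))) : EuclideanSpace ℝ (Fin d) → ℝ :=
  b.normed volume

lemma rho_zero {x : EuclideanSpace ℝ (Fin d)} (hx : b.rOut ≤ ‖x‖) : rho b x = 0 := by
  by_contra hne
  have : x ∈ Function.support (rho b) := hne
  rw [b.support_normed_eq] at this
  simp at this
  linarith

lemma rho_shift_int (x : EuclideanSpace ℝ (Fin d)) : Integrable (fun y => rho b (x - y)) :=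
  b.integrable_normed.comp_sub_left x

lemma rho_shift_one (x : EuclideanSpace ℝ (Fin d)) : ∫ y, rho b (x - y) = 1 := by
  rw [integral_sub_left_eq_self (rho b) volume x, b.integral_normed]

lemma cv_eq_conv (f : EuclideanSpace ℝ (Fin d) → ℝ) :
    cv (rho b) f = convolution (rho b) f (ContinuousLinearMap.lsmul ℝ ℝ) volume := by
  funext x
  rw [convolution_lsmul_swap]
  rfl

lemma cv_eq' (f : EuclideanSpace ℝ (Fin d) → ℝ) (x) : cv (rho b) f x = ∫ t, rho b t * f (x - t) := by
  rw [cv_eq_conv]; rfl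

lemma JHyp.rho_bound (h : JHyp d j κ) (hb : b.rOut ≤ 1) {g : EuclideanSpace ℝ (Fin d) → ℝ}
    (hg : AEStronglyMeasurable g) {C : ℝ} (hC : 0 ≤ C) (hgC : ∀ x, |g x| ≤ C * wt d j x) :
    (∀ x, Integrable (fun y => rho b (x - y) * g y)) ∧
      ∀ x, cv (rho b) (fun y => |g y|) x ≤ (C * κ) * wt d j x := by
  have hpt : ∀ x y, rho b (x - y) * |g y| ≤ rho b (x - y) * ((C * κ) * wt d j x) := by
    intro x y
    by_cases hxy : b.rOut ≤ ‖x - y‖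
    · simp [rho_zero b hxy]
    · refine mul_le_mul_of_nonneg_left ?_ (b.nonneg_normed _)
      refine (hgC y).trans ?_
      rw [mul_assoc]
      gcongr
      exact h.wt_harnack x y ((not_le.mp hxy).le.trans hb)
  have hint : ∀ x, Integrable (fun y => rho b (x - y) * g y) := fun x => by
    refine ((rho_shift_int b x).mul_const ((C * κ) * wt d j x)).mono'
      ((rho_shift_int b x).aestronglyMeasurable.mul hg) (Eventually.of_forall fun y => ?_)
    rw [norm_mul, Real.norm_of_nonneg (b.nonneg_normed _)]
    exact hpt x y
  refine ⟨hint, fun x => ?_⟩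
  have : (C * κ) * wt d j x = ∫ y, rho b (x - y) * ((C * κ) * wt d j x) := by
    rw [integral_mul_const, rho_shift_one, one_mul]
  rw [this]
  refine integral_mono ?_ ((rho_shift_int b x).mul_const _) (hpt x)
  refine (hint x).norm.congr (Eventually.of_forall fun y => ?_)
  simp only
  rw [norm_mul, Real.norm_of_nonneg (b.nonneg_normed _)]
  rfl

lemma JHyp.cv_truncL (h : JHyp d j κ) {δ : ℝ} (hδ : 0 < δ)
    {ψ : EuclideanSpace ℝ (Fin d) → ℝ} (hc : Continuous ψ)
    (hs : HasCompactSupport ψ) (x) :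
    cv (rho b) (fun y => truncL d j ψ y δ) x = truncL d j (cv (rho b) ψ) x δ := by
  obtain ⟨M, hM0, hM⟩ := val_bound hc hs
  rw [cv_eq', truncL_eq_ker]
  have hi : ∀ z, Integrable (fun t => rho b t * ψ (z - t)) := fun z => by
    refine b.integrable_normed.mul_bdd (c := M) (Continuous.aestronglyMeasurable (by fun_prop)) ?_
    filter_upwards with y using hM _
  have e1 : ∀ t, rho b t * truncL d j ψ (x - t) δ =
      ∫ y, (ψ (x - t + y) - ψ (x - t)) * (rho b t * jker d j δ y) := fun t => by
    rw [truncL_eq_ker, ← integral_const_mul]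
    congr 1
    funext y
    ring
  have e2 : ∀ y, (cv (rho b) ψ (x + y) - cv (rho b) ψ x) * jker d j δ y =
      ∫ t, (ψ (x - t + y) - ψ (x - t)) * (rho b t * jker d j δ y) := fun y => by
    rw [cv_eq', cv_eq', ← integral_sub (hi _) (hi _), ← integral_mul_const]
    congr 1
    funext t
    have : x + y - t = x - t + y := by abel
    rw [this]
    ring
  simp_rw [e1, e2]
  apply integral_integral_swap
  have := (b.integrable_normed (μ := volume)).mul_prod (h.jker_int hδ)
  refine this.bdd_mul (c := 2 * M) (Continuous.aestronglyMeasurable (by fun_prop)) ?_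
  filter_upwards with p
  have h1 := abs_le.mp (hM (x - p.1 + p.2))
  have h3 := abs_le.mp (hM (x - p.1))
  rw [Real.norm_eq_abs, abs_le]
  constructor <;> linarith

end bump
end third
section fourth
variable {d : ℕ} {j : ℝ → ℝ} {κ : ℝ}

lemma JHyp.truncL_meas (h : JHyp d j κ) {δ : ℝ} (hδ : 0 < δ)
    {ψ : EuclideanSpace ℝ (Fin d) → ℝ} (hc : Continuous ψ) :
    StronglyMeasurable (fun x => truncL d j ψ x δ) := by
  simp_rw [truncL_eq_ker]
  have : StronglyMeasurable (fun p : EuclideanSpace ℝ (Fin d) × EuclideanSpace ℝ (Fin d) =>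
      (ψ (p.1 + p.2) - ψ p.1) * jker d j δ p.2) := by
    refine StronglyMeasurable.mul (Continuous.stronglyMeasurable (by fun_prop)) ?_
    exact ((h.jker_meas hδ).comp measurable_snd).stronglyMeasurable
  exact this.integral_prod_right'

lemma JHyp.L_meas (h : JHyp d j κ)
    {ψ Lψ : EuclideanSpace ℝ (Fin d) → ℝ} (hc : Continuous ψ)
    (hL : ∀ x, HasPVLim d j ψ x (Lψ x)) : AEStronglyMeasurable Lψ := by
  have hs : Tendsto (fun n : ℕ => 1 / ((n : ℝ) + 1)) atTop (𝓝[>] 0) := by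
    rw [tendsto_nhdsWithin_iff]
    exact ⟨tendsto_one_div_add_atTop_nhds_zero_nat, Eventually.of_forall fun n => by
      simp only [mem_Ioi]; positivity⟩
  refine aestronglyMeasurable_of_tendsto_ae atTop
    (f := fun (n : ℕ) x => truncL d j ψ x (1 / ((n : ℝ) + 1))) (fun n => ?_) ?_
  · exact (h.truncL_meas (by positivity) hc).aestronglyMeasurable
  · filter_upwards with x using (hL x).comp hs

lemma JHyp.L_bound (hd : 2 ≤ d) (h : JHyp d j κ)
    {ψ Lψ : EuclideanSpace ℝ (Fin d) → ℝ} (hc : ContDiff ℝ (⊤ : ℕ∞) ψ) (hs : HasCompactSupport ψ)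
    (hL : ∀ x, HasPVLim d j ψ x (Lψ x)) : ∃ C : ℝ, 0 ≤ C ∧ ∀ x, |Lψ x| ≤ C * wt d j x := by
  obtain ⟨C, hC0, hC⟩ := h.truncL_bound hd hc hs
  refine ⟨C, hC0, fun x => ?_⟩
  refine le_of_tendsto (hL x).abs ?_
  filter_upwards [self_mem_nhdsWithin] with δ hδ using hC δ hδ x

lemma JHyp.L_tendsto (hd : 2 ≤ d) (h : JHyp d j κ)
    {ψ Lψ : EuclideanSpace ℝ (Fin d) → ℝ} (hc : ContDiff ℝ (⊤ : ℕ∞) ψ) (hs : HasCompactSupport ψ)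
    (hL : ∀ x, HasPVLim d j ψ x (Lψ x)) {f : EuclideanSpace ℝ (Fin d) → ℝ}
    (hf : AEStronglyMeasurable f) (hfw : Integrable (fun x => f x * wt d j x)) :
    Tendsto (fun δ => ∫ x, f x * truncL d j ψ x δ) (𝓝[>] 0) (𝓝 (∫ x, f x * Lψ x)) := by
  obtain ⟨C, hC0, hC⟩ := h.truncL_bound hd hc hs
  apply tendsto_integral_filter_of_dominated_convergence _ _ _ (hfw.norm.const_mul C)
  · filter_upwards with x using (hL x).const_mul _
  · filter_upwards [self_mem_nhdsWithin] with δ hδ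
    exact hf.mul (h.truncL_meas hδ hc.continuous).aestronglyMeasurable
  · filter_upwards [self_mem_nhdsWithin] with δ hδ
    filter_upwards with x
    rw [norm_mul, norm_mul, Real.norm_of_nonneg (h.wt_pos x).le, mul_left_comm]
    gcongr
    exact hC δ hδ x

lemma JHyp.cv_abs_int (h : JHyp d j κ) (b : ContDiffBump (0 : EuclideanSpace ℝ (Fin d)))
    (hb : b.rOut ≤ 1) {u : EuclideanSpace ℝ (Fin d) → ℝ}
    (hu : AEStronglyMeasurable u) (huw : Integrable (fun x => u x * wt d j x)) :
    Integrable (fun y => wt d j y * cv (rho b) (fun x => |u x|) y) ∧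
    ∫ y, wt d j y * cv (rho b) (fun x => |u x|) y = ∫ x, |u x| * cv (rho b) (wt d j) x := by
  have huw' : Integrable (fun x => |u x| * wt d j x) := by
    refine huw.norm.congr (Eventually.of_forall fun x => ?_)
    simp only
    rw [norm_mul, Real.norm_of_nonneg (h.wt_pos x).le]
    rfl
  have hr := h.rho_bound b hb h.wt_meas.aestronglyMeasurable zero_le_one (fun x => by
    rw [abs_of_pos (h.wt_pos x), one_mul])
  have P := h.pair_int (b.continuous_normed (μ := volume)).measurable
    b.nonneg_normed hu.norm h.wt_meas.aestronglyMeasurable hr.1 hr.2 huw'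
  exact ⟨pair_int_right b.normed_neg P, (sym_pair b.normed_neg P).symm⟩

lemma cv_abs_le (b : ContDiffBump (0 : EuclideanSpace ℝ (Fin d)))
    (u : EuclideanSpace ℝ (Fin d) → ℝ) (x) :
    |cv (rho b) u x| ≤ cv (rho b) (fun x => |u x|) x := by
  unfold cv
  refine (abs_integral_le_integral_abs).trans_eq ?_
  simp_rw [abs_mul, abs_of_nonneg (b.nonneg_normed _)]

lemma cv_smooth (b : ContDiffBump (0 : EuclideanSpace ℝ (Fin d)))
    {u : EuclideanSpace ℝ (Fin d) → ℝ} (hu : LocallyIntegrable u) :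
    ContDiff ℝ (⊤ : ℕ∞) (cv (rho b) u) := by
  rw [cv_eq_conv]
  exact b.hasCompactSupport_normed.contDiff_convolution_left _ b.contDiff_normed hu

lemma JHyp.cv_wt_int (h : JHyp d j κ) (b : ContDiffBump (0 : EuclideanSpace ℝ (Fin d)))
    (hb : b.rOut ≤ 1) {u : EuclideanSpace ℝ (Fin d) → ℝ}
    (hul : LocallyIntegrable u) (huw : Integrable (fun x => u x * wt d j x)) :
    Integrable (fun x => cv (rho b) u x * wt d j x) := by
  refine (h.cv_abs_int b hb hul.aestronglyMeasurable huw).1.mono'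
    ((cv_smooth b hul).continuous.aestronglyMeasurable.mul h.wt_meas.aestronglyMeasurable) ?_
  filter_upwards with x
  rw [norm_mul, Real.norm_of_nonneg (h.wt_pos x).le, mul_comm]
  gcongr
  · exact (h.wt_pos x).le
  · exact cv_abs_le b u x

lemma cv_zero (b : ContDiffBump (0 : EuclideanSpace ℝ (Fin d)))
    {ψ : EuclideanSpace ℝ (Fin d) → ℝ} {S : Set (EuclideanSpace ℝ (Fin d))}
    (hS : tsupport ψ ⊆ S) {x} (hx : x ∉ Metric.cthickening b.rOut S) : cv (rho b) ψ x = 0 := by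
  unfold cv
  rw [← integral_zero (EuclideanSpace ℝ (Fin d)) ℝ]
  congr 1
  funext y
  by_cases hy : ψ y = 0
  · simp [hy]
  · have hyS : y ∈ S := hS (subset_tsupport _ hy)
    by_cases hxy : b.rOut ≤ ‖x - y‖
    · simp [rho_zero b hxy]
    · exact absurd (Metric.mem_cthickening_of_dist_le x y _ S hyS
        (by rw [dist_eq_norm]; exact (not_le.mp hxy).le)) hx

lemma tsupport_cv (b : ContDiffBump (0 : EuclideanSpace ℝ (Fin d)))
    {ψ : EuclideanSpace ℝ (Fin d) → ℝ} {S : Set (EuclideanSpace ℝ (Fin d))}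
    (hS : tsupport ψ ⊆ S) : tsupport (cv (rho b) ψ) ⊆ Metric.cthickening b.rOut S := by
  refine closure_minimal ?_ Metric.isClosed_cthickening
  intro x hx
  by_contra hne
  exact hx (cv_zero b hS hne)

lemma JHyp.mollified (hd : 2 ≤ d) (h : JHyp d j κ)
    {Ω : Set (EuclideanSpace ℝ (Fin d))} {F u : EuclideanSpace ℝ (Fin d) → ℝ}
    (hul : LocallyIntegrable u) (huw : Integrable (fun x => u x * wt d j x))
    (husol : ∀ (ξ Lξ : EuclideanSpace ℝ (Fin d) → ℝ), IsTestOn d Ω ξ →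
      (∀ x, HasPVLim d j ξ x (Lξ x)) →
      -∫ x, u x * Lξ x = ∫ x in Ω, F x * ξ x)
    {ξ Lξ : EuclideanSpace ℝ (Fin d) → ℝ} (hξ : IsTestOn d Ω ξ) (hξnn : ∀ x, 0 ≤ ξ x)
    (hLξ : ∀ x, HasPVLim d j ξ x (Lξ x))
    {φ φ' : ℝ → ℝ} (hφc : Continuous φ) (hφ'c : ContDiff ℝ (⊤ : ℕ∞) φ')
    (hφb : ∀ t, |φ t| ≤ |t|) (hconv : ∀ a b, φ' a * (b - a) ≤ φ b - φ a)
    (b : ContDiffBump (0 : EuclideanSpace ℝ (Fin d))) (hb : b.rOut ≤ 1)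
    (hbΩ : Metric.cthickening b.rOut (tsupport ξ) ⊆ Ω) :
    -∫ x, φ (cv (rho b) u x) * Lξ x ≤
      ∫ x in Ω, F x * cv (rho b) (fun y => φ' (cv (rho b) u y) * ξ y) x := by
  obtain ⟨hξc, hξs, hξΩ⟩ := hξ
  set v := cv (rho b) u with hvdef
  have hv : ContDiff ℝ (⊤ : ℕ∞) v := cv_smooth b hul
  have hvw : Integrable (fun x => v x * wt d j x) := h.cv_wt_int b hb hul huw
  set ψ : EuclideanSpace ℝ (Fin d) → ℝ := fun y => φ' (v y) * ξ y with hψ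
  have hψc : ContDiff ℝ (⊤ : ℕ∞) ψ := (hφ'c.comp hv).mul hξc
  have hψs : HasCompactSupport ψ := hξs.mul_left
  have hψt : tsupport ψ ⊆ tsupport ξ := tsupport_mul_subset_right
  have hχc : ContDiff ℝ (⊤ : ℕ∞) (cv (rho b) ψ) :=
    cv_smooth b hψc.continuous.locallyIntegrable
  have hχt := tsupport_cv b hψt
  have hχs : HasCompactSupport (cv (rho b) ψ) :=
    hξs.isCompact.cthickening.of_isClosed_subset (isClosed_tsupport _) hχt
  obtain ⟨Lχ, hLχ⟩ := h.exists_lim hd hχc hχs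
  rw [← husol _ Lχ ⟨hχc, hχs, hχt.trans hbΩ⟩ hLχ]
  apply neg_le_neg
  have hφw : Integrable (fun x => φ (v x) * wt d j x) := by
    refine hvw.mono ((hφc.comp hv.continuous).aestronglyMeasurable.mul
      h.wt_meas.aestronglyMeasurable) ?_
    filter_upwards with x
    rw [norm_mul, norm_mul]
    gcongr
    exact hφb _
  refine le_of_tendsto_of_tendsto (h.L_tendsto hd hχc hχs hLχ hul.aestronglyMeasurable huw)
    (h.L_tendsto hd hξc hξs hLξ (hφc.comp hv.continuous).aestronglyMeasurable hφw) ?_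
  filter_upwards [self_mem_nhdsWithin] with δ hδ
  refine le_trans (le_of_eq ?_) (h.convex_step hδ hφc hφ'c.continuous hφb hconv hv.continuous hvw
    hξc.continuous hξs hξnn)
  obtain ⟨C, hC0, hC⟩ := h.truncL_bound hd hψc hψs
  have hTm := (h.truncL_meas hδ hψc.continuous).aestronglyMeasurable (μ := volume)
  have hr := h.rho_bound b hb hTm hC0 (hC δ hδ)
  have P := h.pair_int (b.continuous_normed (μ := volume)).measurable
    b.nonneg_normed hul.aestronglyMeasurable hTm hr.1 hr.2 huw
  have := sym_pair (K := rho b) (g := fun y => truncL d j ψ y δ) b.normed_neg P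
  simp_rw [h.cv_truncL b hδ hψc.continuous hψs] at this
  rw [this]
  congr 1
  funext x
  rw [mul_comm]

end fourth
section fifth
variable {d : ℕ} {j : ℝ → ℝ} {κ : ℝ}

/-- the mollifier sequence -/
def bs (d : ℕ) (r : ℝ) (hr : 0 < r) (n : ℕ) : ContDiffBump (0 : EuclideanSpace ℝ (Fin d)) where
  rIn := r / (n + 1) / 2
  rOut := r / (n + 1)
  rIn_pos := by positivity
  rIn_lt_rOut := half_lt_self (by positivity)

lemma bs_rOut (r : ℝ) (hr : 0 < r) (n : ℕ) : (bs d r hr n).rOut = r / (n + 1) := rfl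

lemma bs_le (r : ℝ) (hr : 0 < r) (n : ℕ) : (bs d r hr n).rOut ≤ r := by
  rw [bs_rOut]
  exact div_le_self hr.le (by linarith [(Nat.cast_nonneg n : (0:ℝ) ≤ n)])

lemma bs_tendsto (r : ℝ) (hr : 0 < r) : Tendsto (fun n => (bs d r hr n).rOut) atTop (𝓝 0) := by
  simp_rw [bs_rOut]
  have := (tendsto_one_div_add_atTop_nhds_zero_nat (𝕜 := ℝ)).const_mul r
  simpa [div_eq_mul_inv] using this

lemma bs_ratio (r : ℝ) (hr : 0 < r) (n : ℕ) :
    (bs d r hr n).rOut ≤ 2 * (bs d r hr n).rIn := by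
  show r / (n + 1) ≤ 2 * (r / (n + 1) / 2)
  linarith

lemma ae_cv (r : ℝ) (hr : 0 < r) {g : EuclideanSpace ℝ (Fin d) → ℝ} (hg : LocallyIntegrable g) :
    ∀ᵐ x, Tendsto (fun n => cv (rho (bs d r hr n)) g x) atTop (𝓝 (g x)) := by
  simp_rw [cv_eq_conv]
  exact ContDiffBump.ae_convolution_tendsto_right_of_locallyIntegrable (bs_tendsto r hr)
    (Eventually.of_forall (bs_ratio r hr)) hg

lemma cv_dist (b : ContDiffBump (0 : EuclideanSpace ℝ (Fin d))) (hb : b.rOut ≤ 2 * b.rIn)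
    {u : EuclideanSpace ℝ (Fin d) → ℝ} (hu : LocallyIntegrable u)
    (x y : EuclideanSpace ℝ (Fin d)) (hy : y ∈ Metric.ball x b.rOut) :
    |cv (rho b) u y - u x| ≤
      (2 ^ d * 2 ^ d) * ⨍ z in Metric.closedBall x (2 * b.rOut), ‖u z - u x‖ := by
  have hd1 : Module.finrank ℝ (EuclideanSpace ℝ (Fin d)) = d := by simp
  have hvol : volume.real (Metric.closedBall x (2 * b.rOut)) =
      2 ^ d * volume.real (Metric.closedBall (0 : EuclideanSpace ℝ (Fin d)) b.rOut) := by
    rw [Measure.addHaar_real_closedBall _ _ (by linarith [b.rOut_pos]),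
      Measure.addHaar_real_closedBall _ _ b.rOut_pos.le, hd1]
    ring
  have hvpos : 0 < volume.real (Metric.closedBall (0 : EuclideanSpace ℝ (Fin d)) b.rOut) :=
    ENNReal.toReal_pos (Metric.measure_closedBall_pos _ _ b.rOut_pos).ne'
      measure_closedBall_lt_top.ne
  set V := volume.real (Metric.closedBall (0 : EuclideanSpace ℝ (Fin d)) b.rOut) with hV
  have hle : ∀ z, rho b z ≤ 2 ^ d / V := fun z => by
    have := b.normed_le_div_measure_closedBall_rOut volume 2 hb z
    rwa [hd1] at this
  set B := Metric.closedBall x (2 * b.rOut) with hB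
  have hion : IntegrableOn (fun z => ‖u z - u x‖) B :=
    ((hu.integrableOn_isCompact (isCompact_closedBall _ _)).sub
      (integrableOn_const measure_closedBall_lt_top.ne)).norm
  have hG : Integrable (fun z => (2 ^ d / V) * indicator B (fun z => ‖u z - u x‖) z) :=
    ((integrable_indicator_iff Metric.isClosed_closedBall.measurableSet).mpr hion).const_mul _
  have hpt : ∀ z, ‖rho b (y - z) * (u z - u x)‖ ≤
      (2 ^ d / V) * indicator B (fun z => ‖u z - u x‖) z := fun z => by
    by_cases hz : z ∈ B
    · rw [indicator_of_mem hz, norm_mul, Real.norm_of_nonneg (b.nonneg_normed _)]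
      gcongr
      exact hle _
    · have : b.rOut ≤ ‖y - z‖ := by
        by_contra hlt
        apply hz
        rw [hB, Metric.mem_closedBall]
        have h1 := dist_triangle z y x
        have h2 : dist z y = ‖y - z‖ := by rw [dist_comm, dist_eq_norm]
        have h3 := Metric.mem_ball.mp hy
        linarith
      simp [rho_zero b this, indicator_of_notMem hz]
  have hm : AEStronglyMeasurable (fun z => rho b (y - z) * (u z - u x)) :=
    (rho_shift_int b y).aestronglyMeasurable.mul
      (hu.aestronglyMeasurable.sub aestronglyMeasurable_const)
  have i1 : Integrable (fun z => rho b (y - z) * (u z - u x)) :=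
    hG.mono' hm (Eventually.of_forall hpt)
  have e1 : cv (rho b) u y - u x = ∫ z, rho b (y - z) * (u z - u x) := by
    have i2 := (rho_shift_int b y).mul_const (u x)
    have : cv (rho b) u y = ∫ z, (rho b (y - z) * (u z - u x) + rho b (y - z) * u x) := by
      unfold cv
      congr 1
      funext z
      ring
    rw [this, integral_add i1 i2, integral_mul_const, rho_shift_one]
    ring
  rw [e1]
  refine (norm_integral_le_of_norm_le hG (Eventually.of_forall hpt)).trans_eq ?_
  rw [integral_const_mul, integral_indicator Metric.isClosed_closedBall.measurableSet,
    setAverage_eq, hvol, smul_eq_mul]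
  field_simp
  rfl

lemma ae_cv_unif (r : ℝ) (hr : 0 < r) {u : EuclideanSpace ℝ (Fin d) → ℝ}
    (hu : LocallyIntegrable u) :
    ∀ᵐ x, ∀ ε > 0, ∀ᶠ n in atTop, ∀ y ∈ Metric.ball x (bs d r hr n).rOut,
      |cv (rho (bs d r hr n)) u y - u x| ≤ ε := by
  filter_upwards [(Besicovitch.vitaliFamily (volume : Measure (EuclideanSpace ℝ (Fin d)))).ae_tendsto_average_norm_sub hu] with x hx ε hε
  have h2 : Tendsto (fun n => 2 * (bs d r hr n).rOut) atTop (𝓝[>] 0) := by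
    refine tendsto_nhdsWithin_iff.2 ⟨?_, Eventually.of_forall fun n => ?_⟩
    · simpa using (bs_tendsto (d := d) r hr).const_mul 2
    · simp only [mem_Ioi]
      linarith [(bs d r hr n).rOut_pos]
  have h3 := ((hx.comp (Besicovitch.tendsto_filterAt volume x)).comp h2).const_mul
    ((2:ℝ) ^ d * 2 ^ d)
  rw [mul_zero] at h3
  filter_upwards [h3.eventually (Iio_mem_nhds hε)] with n hn y hy
  exact (cv_dist _ (bs_ratio r hr n) hu x y hy).trans (le_of_lt hn)

lemma ae_chi (r : ℝ) (hr : 0 < r) {u ξ : EuclideanSpace ℝ (Fin d) → ℝ} {φ' : ℝ → ℝ}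
    (hu : LocallyIntegrable u) (hφ' : Continuous φ') (hξ : Continuous ξ) :
    ∀ᵐ x, Tendsto (fun n => cv (rho (bs d r hr n))
      (fun y => φ' (cv (rho (bs d r hr n)) u y) * ξ y) x) atTop (𝓝 (φ' (u x) * ξ x)) := by
  filter_upwards [ae_cv_unif r hr hu] with x hx
  rw [Metric.tendsto_nhds]
  intro ε hε
  have hcont : ContinuousAt (fun p : ℝ × EuclideanSpace ℝ (Fin d) => φ' p.1 * ξ p.2) (u x, x) :=
    Continuous.continuousAt (by fun_prop)
  obtain ⟨δ, hδ, hδ'⟩ := Metric.continuousAt_iff.mp hcont (ε / 2) (by positivity)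
  filter_upwards [hx (δ / 2) (by positivity),
    (bs_tendsto (d := d) r hr).eventually (Iio_mem_nhds hδ)] with n hn hn2
  refine lt_of_le_of_lt ?_ (half_lt_self hε)
  rw [cv_eq_conv]
  set b := bs d r hr n
  refine dist_convolution_le (R := b.rOut) (by positivity) b.support_normed_eq.subset
    b.nonneg_normed b.integral_normed ?_ ?_
  · have := (cv_smooth b hu).continuous
    exact Continuous.aestronglyMeasurable (by fun_prop)
  · intro y hy
    refine (hδ' (x := (cv (rho b) u y, y)) ?_).le
    rw [Prod.dist_eq]
    refine max_lt ?_ ((Metric.mem_ball.mp hy).trans hn2)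
    rw [Real.dist_eq]
    exact (hn y hy).trans_lt (half_lt_self hδ)

lemma fatou_real {α : Type*} [MeasurableSpace α] {μ : Measure α} {f : ℕ → α → ℝ} {g : α → ℝ}
    {a : ℕ → ℝ} {A : ℝ} (hf : ∀ n, Integrable (f n) μ) (hf0 : ∀ n, 0 ≤ᵐ[μ] f n)
    (hg : Integrable g μ) (hlim : ∀ᵐ x ∂μ, Tendsto (fun n => f n x) atTop (𝓝 (g x)))
    (hle : ∀ n, ∫ x, f n x ∂μ ≤ a n) (ha : Tendsto a atTop (𝓝 A)) : ∫ x, g x ∂μ ≤ A := by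
  have hg0 : 0 ≤ᵐ[μ] g := by
    filter_upwards [hlim, ae_all_iff.mpr hf0] with x hx h0
    exact ge_of_tendsto hx (Eventually.of_forall h0)
  have hA : 0 ≤ A := ge_of_tendsto ha (Eventually.of_forall fun n =>
    (integral_nonneg_of_ae (hf0 n)).trans (hle n))
  rw [← ENNReal.ofReal_le_ofReal_iff hA, ofReal_integral_eq_lintegral_ofReal hg hg0]
  calc ∫⁻ x, ENNReal.ofReal (g x) ∂μ
      = ∫⁻ x, liminf (fun n => ENNReal.ofReal (f n x)) atTop ∂μ := by
        apply lintegral_congr_ae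
        filter_upwards [hlim] with x hx
        exact ((ENNReal.tendsto_ofReal hx).liminf_eq).symm
    _ ≤ liminf (fun n => ∫⁻ x, ENNReal.ofReal (f n x) ∂μ) atTop :=
        lintegral_liminf_le' fun n => (hf n).aemeasurable.ennreal_ofReal
    _ ≤ liminf (fun n => ENNReal.ofReal (a n)) atTop := by
        refine liminf_le_liminf (Eventually.of_forall fun n => ?_)
        rw [← ofReal_integral_eq_lintegral_ofReal (hf n) (hf0 n)]
        exact ENNReal.ofReal_le_ofReal (hle n)
    _ = ENNReal.ofReal A := (ENNReal.tendsto_ofReal ha).liminf_eq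

lemma JHyp.smooth_kato (hd : 2 ≤ d) (h : JHyp d j κ)
    {Ω : Set (EuclideanSpace ℝ (Fin d))} (hΩo : IsOpen Ω) {F u : EuclideanSpace ℝ (Fin d) → ℝ}
    (hF : LocallyIntegrableOn F Ω)
    (hul : LocallyIntegrable u) (huw : Integrable (fun x => u x * wt d j x))
    (husol : ∀ (ξ Lξ : EuclideanSpace ℝ (Fin d) → ℝ), IsTestOn d Ω ξ →
      (∀ x, HasPVLim d j ξ x (Lξ x)) →
      -∫ x, u x * Lξ x = ∫ x in Ω, F x * ξ x)
    {ξ Lξ : EuclideanSpace ℝ (Fin d) → ℝ} (hξ : IsTestOn d Ω ξ) (hξnn : ∀ x, 0 ≤ ξ x)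
    (hLξ : ∀ x, HasPVLim d j ξ x (Lξ x))
    {φ φ' : ℝ → ℝ} (hφc : Continuous φ) (hφ'c : ContDiff ℝ (⊤ : ℕ∞) φ')
    (hφb : ∀ t, |φ t| ≤ |t|) (hφ'b : ∀ t, |φ' t| ≤ 1)
    (hconv : ∀ a b, φ' a * (b - a) ≤ φ b - φ a) :
    -∫ x, φ (u x) * Lξ x ≤ ∫ x in Ω, F x * (φ' (u x) * ξ x) := by
  have hξ' := hξ
  obtain ⟨hξc, hξs, hξΩ⟩ := hξ'
  obtain ⟨r₁, hr₁, hr₁Ω⟩ := hξs.isCompact.exists_cthickening_subset_open hΩo hξΩ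
  set r := min r₁ 1 with hrdef
  have hr : 0 < r := lt_min hr₁ one_pos
  have hrΩ : Metric.cthickening r (tsupport ξ) ⊆ Ω :=
    (Metric.cthickening_mono (min_le_left _ _) _).trans hr₁Ω
  have hu := hul.aestronglyMeasurable
  have hb1 : ∀ n, (bs d r hr n).rOut ≤ 1 := fun n => (bs_le r hr n).trans (min_le_right _ _)
  have hcth : ∀ n, Metric.cthickening (bs d r hr n).rOut (tsupport ξ) ⊆
      Metric.cthickening r (tsupport ξ) := fun n => Metric.cthickening_mono (bs_le r hr n) _
  obtain ⟨C, hC0, hC⟩ := h.L_bound hd hξc hξs hLξ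
  have hLm := h.L_meas hξc.continuous hLξ
  obtain ⟨M, hM0, hM⟩ := val_bound hξc.continuous hξs
  have hwl : LocallyIntegrable (wt d j) := by
    refine (continuous_const (y := j 1)).locallyIntegrable.mono h.wt_meas.aestronglyMeasurable ?_
    filter_upwards with x
    rw [Real.norm_of_nonneg (h.wt_pos x).le]
    exact (h.wt_le x).trans (le_abs_self _)
  have huw' : Integrable (fun x => |u x| * wt d j x) := by
    refine huw.norm.congr (Eventually.of_forall fun x => ?_)
    simp only
    rw [norm_mul, Real.norm_of_nonneg (h.wt_pos x).le]
    rfl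
  -- right hand sides converge
  have hR : Tendsto (fun n => ∫ x in Ω, F x * cv (rho (bs d r hr n))
      (fun y => φ' (cv (rho (bs d r hr n)) u y) * ξ y) x) atTop
      (𝓝 (∫ x in Ω, F x * (φ' (u x) * ξ x))) := by
    have hK : IsCompact (Metric.cthickening r (tsupport ξ)) := hξs.isCompact.cthickening
    have hFK : IntegrableOn F (Metric.cthickening r (tsupport ξ)) :=
      hF.integrableOn_compact_subset hrΩ hK
    have hbd : Integrable (indicator (Metric.cthickening r (tsupport ξ)) (fun x => ‖F x‖ * M)) :=
      (integrable_indicator_iff hK.measurableSet).mpr (hFK.norm.mul_const M)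
    apply tendsto_integral_of_dominated_convergence _ _ hbd.integrableOn
    · intro n
      filter_upwards with x
      by_cases hx : x ∈ Metric.cthickening r (tsupport ξ)
      · rw [indicator_of_mem hx, norm_mul]
        gcongr
        rw [← dist_zero_right, cv_eq_conv]
        have := (cv_smooth (bs d r hr n) hul).continuous
        have := hφ'c.continuous
        have := hξc.continuous
        refine dist_convolution_le (R := (bs d r hr n).rOut) hM0
          (bs d r hr n).support_normed_eq.subset
          (bs d r hr n).nonneg_normed (bs d r hr n).integral_normed
          (Continuous.aestronglyMeasurable (by fun_prop)) (fun y _ => ?_)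
        rw [dist_zero_right, norm_mul]
        calc _ ≤ 1 * M := mul_le_mul (hφ'b _) (hM y) (abs_nonneg _) zero_le_one
          _ = M := one_mul M
      · rw [cv_zero (S := tsupport ξ) _ tsupport_mul_subset_right (fun hx' => hx (hcth n hx'))]
        simp [indicator_of_notMem hx]
    · exact ae_restrict_of_ae ((ae_chi r hr hul hφ'c.continuous hξc.continuous).mono
        fun x hx => hx.const_mul _)
    · intro n
      refine hF.aestronglyMeasurable.mul ?_
      have h1 := (cv_smooth (bs d r hr n) hul).continuous
      have h2 := hφ'c.continuous
      have h3 := hξc.continuous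
      have : Continuous (fun y => φ' (cv (rho (bs d r hr n)) u y) * ξ y) := by fun_prop
      exact (cv_smooth _ this.locallyIntegrable).continuous.aestronglyMeasurable
  -- weights converge
  have hW : Tendsto (fun n => ∫ x, |u x| * cv (rho (bs d r hr n)) (wt d j) x) atTop
      (𝓝 (∫ x, |u x| * wt d j x)) := by
    apply tendsto_integral_of_dominated_convergence _ _ (huw'.const_mul κ)
    · intro n
      filter_upwards with x
      have hb := (h.rho_bound (bs d r hr n) (hb1 n) h.wt_meas.aestronglyMeasurable zero_le_one
        (fun x => by rw [abs_of_pos (h.wt_pos x), one_mul])).2 x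
      rw [norm_mul, Real.norm_eq_abs, abs_abs, mul_left_comm]
      refine mul_le_mul_of_nonneg_left ?_ (abs_nonneg _)
      refine (cv_abs_le _ _ _).trans ?_
      rwa [one_mul] at hb
    · filter_upwards [ae_cv r hr hwl] with x hx using hx.const_mul _
    · intro n
      exact hu.norm.mul (cv_smooth _ hwl).continuous.aestronglyMeasurable
  have hfint : ∀ {w : EuclideanSpace ℝ (Fin d) → ℝ}, AEStronglyMeasurable w →
      Integrable (fun x => w x * wt d j x) → Integrable (fun x => φ (w x) * Lξ x) := by
    intro w hwm hww
    refine (hww.norm.const_mul C).mono' ((hφc.comp_aestronglyMeasurable hwm).mul hLm) ?_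
    filter_upwards with x
    rw [norm_mul, norm_mul, Real.norm_of_nonneg (h.wt_pos x).le, mul_left_comm]
    exact mul_le_mul (hφb _) (hC x) (norm_nonneg _) (norm_nonneg _)
  have hCA := fun n => h.cv_abs_int (bs d r hr n) (hb1 n) hu huw
  have hvi := fun n => hfint (cv_smooth (bs d r hr n) hul).continuous.aestronglyMeasurable
    (h.cv_wt_int (bs d r hr n) (hb1 n) hul huw)
  have hui := hfint hu huw
  have hul' : LocallyIntegrable (fun x => |u x|) :=
    hul.mono hu.norm (Eventually.of_forall fun x => (norm_norm (u x)).le)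
  have main := fatou_real (μ := (volume : Measure (EuclideanSpace ℝ (Fin d))))
    (f := fun n x => C * (wt d j x * cv (rho (bs d r hr n)) (fun x => |u x|) x) -
      φ (cv (rho (bs d r hr n)) u x) * Lξ x)
    (g := fun x => C * (|u x| * wt d j x) - φ (u x) * Lξ x)
    (a := fun n => C * (∫ x, |u x| * cv (rho (bs d r hr n)) (wt d j) x) +
      ∫ x in Ω, F x * cv (rho (bs d r hr n))
      (fun y => φ' (cv (rho (bs d r hr n)) u y) * ξ y) x)
    (fun n => ((hCA n).1.const_mul C).sub (hvi n)) (fun n => ?_)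
    ((huw'.const_mul C).sub hui) ?_ (fun n => ?_) ((hW.const_mul C).add hR)
  · rw [integral_sub (huw'.const_mul C) hui, integral_const_mul] at main
    linarith
  · filter_upwards with x
    simp only [Pi.zero_apply, sub_nonneg]
    refine (le_abs_self _).trans ?_
    rw [abs_mul]
    calc _ ≤ cv (rho (bs d r hr n)) (fun x => |u x|) x * (C * wt d j x) :=
          mul_le_mul ((hφb _).trans (cv_abs_le _ _ _)) (hC x) (abs_nonneg _)
            ((abs_nonneg _).trans (cv_abs_le _ u _))
      _ = _ := by ring
  · filter_upwards [ae_cv r hr hul, ae_cv r hr (g := fun x => |u x|) hul'] with x h1 h2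
    refine Tendsto.sub ?_ (((hφc.tendsto _).comp h1).mul_const _)
    rw [mul_comm (|u x|)]
    exact (h2.const_mul _).const_mul _
  · rw [integral_sub ((hCA n).1.const_mul C) (hvi n), integral_const_mul, (hCA n).2]
    have := h.mollified hd hul huw husol hξ hξnn hLξ hφc hφ'c hφb hconv (bs d r hr n) (hb1 n)
      ((hcth n).trans hrΩ)
    linarith

end fifth

section sixth
variable {d : ℕ} {j : ℝ → ℝ} {κ : ℝ}

/-- smooth convex approximation of the absolute value -/
def ph (η t : ℝ) : ℝ := √(t ^ 2 + η ^ 2) - η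

/-- its derivative -/
def dph (η t : ℝ) : ℝ := t / √(t ^ 2 + η ^ 2)

lemma ph_cont (η : ℝ) : Continuous (ph η) := by
  unfold ph
  fun_prop

lemma dph_smooth {η : ℝ} (hη : 0 < η) : ContDiff ℝ (⊤ : ℕ∞) (dph η) := by
  unfold dph
  refine contDiff_id.div (ContDiff.sqrt (by fun_prop) fun t => by positivity) fun t => ?_
  positivity

lemma ph_bound {η : ℝ} (hη : 0 < η) (t : ℝ) : |ph η t| ≤ |t| := by
  unfold ph
  have h1 : η ≤ √(t ^ 2 + η ^ 2) := Real.le_sqrt_of_sq_le (by nlinarith [sq_nonneg t])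
  rw [abs_of_nonneg (by linarith), sub_le_iff_le_add]
  refine Real.sqrt_le_iff.mpr ⟨by positivity, ?_⟩
  have := sq_abs t
  nlinarith [mul_nonneg (abs_nonneg t) hη.le]

lemma dph_bound {η : ℝ} (hη : 0 < η) (t : ℝ) : |dph η t| ≤ 1 := by
  unfold dph
  have h0 : 0 < √(t ^ 2 + η ^ 2) := by positivity
  rw [abs_div, abs_of_pos h0, div_le_one h0]
  refine Real.le_sqrt_of_sq_le ?_
  rw [sq_abs]
  nlinarith

lemma ph_conv {η : ℝ} (hη : 0 < η) (a b : ℝ) : dph η a * (b - a) ≤ ph η b - ph η a := by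
  unfold dph ph
  have h0 : 0 < √(a ^ 2 + η ^ 2) := by positivity
  have hsq : √(a ^ 2 + η ^ 2) * √(a ^ 2 + η ^ 2) = a ^ 2 + η ^ 2 :=
    Real.mul_self_sqrt (by positivity)
  have hcs : a * b + η ^ 2 ≤ √(a ^ 2 + η ^ 2) * √(b ^ 2 + η ^ 2) := by
    rw [← Real.sqrt_mul (by positivity)]
    refine Real.le_sqrt_of_sq_le ?_
    nlinarith [mul_nonneg (sq_nonneg η) (sq_nonneg (a - b))]
  rw [div_mul_eq_mul_div, div_le_iff₀ h0]
  nlinarith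

/-- the sequence of parameters -/
def et (n : ℕ) : ℝ := 1 / ((n : ℝ) + 1)

lemma et_pos (n : ℕ) : 0 < et n := by
  unfold et
  positivity

lemma et_tendsto : Tendsto et atTop (𝓝 0) := tendsto_one_div_add_atTop_nhds_zero_nat

lemma sqrt_lim (t : ℝ) : Tendsto (fun n => √(t ^ 2 + et n ^ 2)) atTop (𝓝 |t|) := by
  have hc : Continuous (fun η : ℝ => √(t ^ 2 + η ^ 2)) := by fun_prop
  have := (hc.tendsto 0).comp et_tendsto
  simpa [Real.sqrt_sq_eq_abs, Function.comp_def] using this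

lemma ph_lim (t : ℝ) : Tendsto (fun n => ph (et n) t) atTop (𝓝 |t|) := by
  simpa [ph] using (sqrt_lim t).sub et_tendsto

lemma dph_lim (t : ℝ) : Tendsto (fun n => dph (et n) t) atTop (𝓝 (Real.sign t)) := by
  rcases lt_trichotomy t 0 with ht | ht | ht
  · have := (tendsto_const_nhds (x := t)).div (sqrt_lim t) (abs_ne_zero.mpr ht.ne)
    rwa [abs_of_neg ht, div_neg, div_self ht.ne, ← Real.sign_of_neg ht] at this
  · subst ht
    simp [dph]
  · have := (tendsto_const_nhds (x := t)).div (sqrt_lim t) (abs_ne_zero.mpr ht.ne')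
    rwa [abs_of_pos ht, div_self ht.ne', ← Real.sign_of_pos ht] at this

lemma JHyp.j_aesm (hd : 2 ≤ d) (h : JHyp d j κ) :
    AEStronglyMeasurable (fun y : EuclideanSpace ℝ (Fin d) => j ‖y‖) := by
  have h1 : AEMeasurable (fun y : EuclideanSpace ℝ (Fin d) =>
      (min 1 (‖y‖ ^ 2) * j ‖y‖) / min 1 (‖y‖ ^ 2)) :=
    h.int.aemeasurable.div (Continuous.aemeasurable (by fun_prop))
  refine (h1.congr ?_).aestronglyMeasurable
  filter_upwards [ae_ne_zero hd] with y hy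
  have : 0 < min 1 (‖y‖ ^ 2) := lt_min one_pos (by positivity)
  field_simp

lemma JHyp.u_aesm (hd : 2 ≤ d) (h : JHyp d j κ) {u : EuclideanSpace ℝ (Fin d) → ℝ}
    (huL1 : Integrable (fun x => u x * min 1 (j ‖x‖))) : AEStronglyMeasurable u := by
  have h1 : AEMeasurable (fun y : EuclideanSpace ℝ (Fin d) =>
      (u y * min 1 (j ‖y‖)) / min 1 (j ‖y‖)) :=
    huL1.aemeasurable.div (aemeasurable_const.min (h.j_aesm hd).aemeasurable)
  refine (h1.congr ?_).aestronglyMeasurable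
  filter_upwards [ae_ne_zero hd] with y hy
  have : 0 < min 1 (j ‖y‖) := lt_min one_pos (h.pos _ (norm_pos_iff.mpr hy))
  field_simp

lemma JHyp.u_wt (hd : 2 ≤ d) (h : JHyp d j κ) {u : EuclideanSpace ℝ (Fin d) → ℝ}
    (huL1 : Integrable (fun x => u x * min 1 (j ‖x‖))) :
    Integrable (fun x => u x * wt d j x) := by
  refine (huL1.norm.const_mul (max 1 (j 1))).mono'
    ((h.u_aesm hd huL1).mul h.wt_meas.aestronglyMeasurable) ?_
  filter_upwards [ae_ne_zero hd] with y hy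
  have hp := norm_pos_iff.mpr hy
  have hj := h.pos _ hp
  have hm : 0 < min 1 (j ‖y‖) := lt_min one_pos hj
  rw [norm_mul, norm_mul, Real.norm_of_nonneg hm.le, Real.norm_of_nonneg (h.wt_pos y).le,
    mul_left_comm]
  refine mul_le_mul_of_nonneg_left ?_ (norm_nonneg _)
  rcases le_total 1 (j ‖y‖) with h1 | h1
  · rw [min_eq_left h1, mul_one]
    exact (h.wt_le y).trans (le_max_right _ _)
  · rw [min_eq_right h1]
    have h2 : wt d j y ≤ j ‖y‖ := h.anti hp (by simp only [mem_Ioi]; linarith) (by linarith)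
    have h3 := le_max_left 1 (j 1)
    nlinarith

lemma JHyp.u_loc (hd : 2 ≤ d) (h : JHyp d j κ) {u : EuclideanSpace ℝ (Fin d) → ℝ}
    (huL1 : Integrable (fun x => u x * min 1 (j ‖x‖))) : LocallyIntegrable u := by
  rw [locallyIntegrable_iff]
  intro K hK
  obtain ⟨R, hR0, hR⟩ := hK.isBounded.exists_pos_norm_le
  have hj := h.pos (1 + R) (by positivity)
  refine Integrable.mono' (g := fun x => (j (1 + R))⁻¹ * ‖u x * wt d j x‖)
    (((h.u_wt hd huL1).norm.const_mul _).integrableOn) (h.u_aesm hd huL1).restrict ?_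
  filter_upwards [ae_restrict_mem hK.measurableSet] with x hx
  rw [norm_mul, Real.norm_of_nonneg (h.wt_pos x).le, inv_mul_eq_div, le_div_iff₀ hj]
  exact mul_le_mul_of_nonneg_left (h.wt_lower hR0.le x (hR x hx)) (norm_nonneg _)

end sixth

/-- Kato's inequality for the nonlocal operator `L`. -/
theorem kato_inequality
    (d : ℕ) (hd : 2 ≤ d)
    (j : ℝ → ℝ) (hjpos : ∀ r > 0, 0 < j r) (hjanti : AntitoneOn j (Set.Ioi 0))
    (hjint : Integrable (fun y : EuclideanSpace ℝ (Fin d) => min 1 (‖y‖ ^ 2) * j ‖y‖))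
    (κ : ℝ) (hκ : 1 ≤ κ) (hjdoub : ∀ r > 0, j r ≤ κ * j (2 * r))
    (Ω : Set (EuclideanSpace ℝ (Fin d))) (hΩo : IsOpen Ω) (hΩb : Bornology.IsBounded Ω)
    (F : EuclideanSpace ℝ (Fin d) → ℝ) (hF : LocallyIntegrableOn F Ω)
    (u : EuclideanSpace ℝ (Fin d) → ℝ)
    (huL1 : Integrable (fun x => u x * min 1 (j ‖x‖)))
    (husol : ∀ (ξ Lξ : EuclideanSpace ℝ (Fin d) → ℝ), IsTestOn d Ω ξ →
      (∀ x, HasPVLim d j ξ x (Lξ x)) →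
      -∫ x, u x * Lξ x = ∫ x in Ω, F x * ξ x)
    (ξ Lξ : EuclideanSpace ℝ (Fin d) → ℝ) (hξ : IsTestOn d Ω ξ) (hξnn : ∀ x, 0 ≤ ξ x)
    (hLξ : ∀ x, HasPVLim d j ξ x (Lξ x)) :
    -∫ x, |u x| * Lξ x ≤ ∫ x in Ω, Real.sign (u x) * F x * ξ x := by

  have h : JHyp d j κ := ⟨hjpos, hjanti, hjint, hκ, hjdoub⟩
  have hum := h.u_aesm hd huL1
  have huw := h.u_wt hd huL1
  have hul := h.u_loc hd huL1
  obtain ⟨C, hC0, hC⟩ := h.L_bound hd hξ.1 hξ.2.1 hLξ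
  have hLm := h.L_meas hξ.1.continuous hLξ
  obtain ⟨M, hM0, hM⟩ := val_bound hξ.1.continuous hξ.2.1
  have key := fun n => h.smooth_kato hd hΩo hF hul huw husol hξ hξnn hLξ (ph_cont (et n))
    (dph_smooth (et_pos n)) (ph_bound (et_pos n)) (dph_bound (et_pos n)) (ph_conv (et_pos n))
  have hL : Tendsto (fun n => ∫ x, ph (et n) (u x) * Lξ x) atTop (𝓝 (∫ x, |u x| * Lξ x)) := by
    apply tendsto_integral_of_dominated_convergence _ _ (huw.norm.const_mul C)
    · intro n
      filter_upwards with x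
      rw [norm_mul, norm_mul, Real.norm_of_nonneg (h.wt_pos x).le, mul_left_comm]
      exact mul_le_mul (ph_bound (et_pos n) _) (hC x) (norm_nonneg _) (norm_nonneg _)
    · filter_upwards with x using (ph_lim (u x)).mul_const _
    · intro n
      exact ((ph_cont (et n)).comp_aestronglyMeasurable hum).mul hLm
  have hR : Tendsto (fun n => ∫ x in Ω, F x * (dph (et n) (u x) * ξ x)) atTop
      (𝓝 (∫ x in Ω, F x * (Real.sign (u x) * ξ x))) := by
    have hK : IsCompact (tsupport ξ) := hξ.2.1.isCompact
    have hFK : IntegrableOn F (tsupport ξ) := hF.integrableOn_compact_subset hξ.2.2 hK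
    have hbd : Integrable (indicator (tsupport ξ) (fun x => ‖F x‖ * M)) :=
      (integrable_indicator_iff hK.measurableSet).mpr (hFK.norm.mul_const M)
    apply tendsto_integral_of_dominated_convergence _ _ hbd.integrableOn
    · intro n
      filter_upwards with x
      by_cases hx : x ∈ tsupport ξ
      · rw [indicator_of_mem hx, norm_mul, norm_mul]
        refine mul_le_mul_of_nonneg_left ?_ (norm_nonneg _)
        calc _ ≤ 1 * M := mul_le_mul (dph_bound (et_pos n) _) (hM x) (abs_nonneg _) zero_le_one
          _ = M := one_mul M
      · simp [image_eq_zero_of_notMem_tsupport hx, indicator_of_notMem hx]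
    · filter_upwards with x using ((dph_lim (u x)).mul_const _).const_mul _
    · intro n
      exact hF.aestronglyMeasurable.mul
        (((dph_smooth (et_pos n)).continuous.comp_aestronglyMeasurable hum.restrict).mul
          hξ.1.continuous.aestronglyMeasurable)
  refine (le_of_tendsto_of_tendsto' hL.neg hR key).trans_eq ?_
  congr 1
  funext x
  ring
end
end

section
/- For every ξ ∈ C_c^∞(ℝ^d) with supp ξ ⊂ {x ∈ Ω : dist(x,∂Ω) > ε₀}, every 0 < ε < ε₀/2, and every v ∈ L¹(ℝ^d, (1∧j(|x|))dx) which is C² on the open set {x ∈ Ω : dist(x,∂Ω) > ε}: the principal-value limit Lv(x) exists for every x with dist(x,∂Ω) > ε₀, the functions x ↦ v(x)Lξ(x) (on ℝ^d) and x ↦ ξ(x)Lv(x) (on {dist(·,∂Ω) > ε₀}) are integrable, and ∫_{ℝ^d} v(x) Lξ(x) dx = ∫_{{x ∈ Ω : dist(x,∂Ω) > ε₀}} ξ(x) Lv(x) dx. -/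
open MeasureTheory Filter Topology Set

noncomputable section

section Helpers

set_option linter.unusedSectionVars false

variable {E : Type*} [NormedAddCommGroup E] [NormedSpace ℝ E] [FiniteDimensional ℝ E]
  [MeasureSpace E] [BorelSpace E] [(volume : Measure E).IsAddHaarMeasure] [Nontrivial E]

/-- Abstract properties of the kernel `k y = j ‖y‖` that are used in the proof. -/
structure KerHyp (k : E → ℝ) : Prop where
  even : ∀ y, k (-y) = k y
  nonneg : ∀ y, y ≠ 0 → 0 < k y
  int : Integrable (fun y : E => min 1 (‖y‖ ^ 2) * k y)
  f1 : ∀ R r : ℝ, 0 < r → ∃ C, 0 ≤ C ∧ ∀ x y, ‖x‖ ≤ R → r ≤ ‖y‖ → x + y ≠ 0 →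
    k y ≤ C * min 1 (k (x + y))
  f2 : ∀ R : ℝ, ∃ C, 0 ≤ C ∧ ∀ x, ‖x‖ ≤ R → x ≠ 0 → 1 ≤ C * min 1 (k x)

/-- The truncated operator. -/
def TL (k : E → ℝ) (w : E → ℝ) (x : E) (r : ℝ) : ℝ :=
  ∫ y in {y : E | r < ‖y‖}, (w (x + y) - w x) * k y

theorem ae_ne_zero' : ∀ᵐ y : E, y ≠ 0 := by
  have : (𝓝[≠] (0 : E)).NeBot := Module.punctured_nhds_neBot ℝ E 0
  exact Measure.ae_ne volume 0

theorem meas_gt (r : ℝ) : MeasurableSet {y : E | r < ‖y‖} :=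
  measurableSet_lt measurable_const measurable_norm

theorem KerHyp.meas {k : E → ℝ} (hk : KerHyp k) : AEStronglyMeasurable k volume := by
  have h1 : AEStronglyMeasurable (fun y : E => (min 1 (‖y‖ ^ 2))⁻¹ * (min 1 (‖y‖ ^ 2) * k y))
      volume := by
    refine AEStronglyMeasurable.mul ?_ hk.int.aestronglyMeasurable
    exact (Measurable.inv (by fun_prop)).aestronglyMeasurable
  refine h1.congr ?_
  filter_upwards [ae_ne_zero' (E := E)] with y hy
  have : 0 < min 1 (‖y‖ ^ 2) := lt_min one_pos (by positivity)
  field_simp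

theorem KerHyp.intOn {k : E → ℝ} (hk : KerHyp k) {r : ℝ} (hr : 0 < r) :
    IntegrableOn k {y : E | r < ‖y‖} := by
  have h0 : 0 < min 1 (r ^ 2) := lt_min one_pos (by positivity)
  refine Integrable.mono' (hk.int.integrableOn.const_mul (min 1 (r ^ 2))⁻¹)
    hk.meas.restrict ?_
  refine (ae_restrict_iff' (meas_gt r)).2 (Eventually.of_forall fun y hy => ?_)
  have hy' : r < ‖y‖ := hy
  have hk0 : 0 < k y := hk.nonneg y (norm_pos_iff.1 (hr.trans hy'))
  rw [Real.norm_of_nonneg hk0.le, ← mul_assoc]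
  have : 1 ≤ (min 1 (r ^ 2))⁻¹ * min 1 (‖y‖ ^ 2) := by
    rw [inv_mul_eq_div, one_le_div h0]
    gcongr
  nlinarith

theorem KerHyp.p_pos {k : E → ℝ} (hk : KerHyp k) {y : E} (hy : y ≠ 0) : 0 < min 1 (k y) :=
  lt_min one_pos (hk.nonneg y hy)

theorem KerHyp.v_meas {k : E → ℝ} (hk : KerHyp k) {v : E → ℝ}
    (hv : Integrable (fun x => v x * min 1 (k x))) : AEStronglyMeasurable v volume := by
  have hm : AEMeasurable (fun x => min 1 (k x)) volume :=
    aemeasurable_const.min hk.meas.aemeasurable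
  have h1 : AEStronglyMeasurable (fun y : E => (v y * min 1 (k y)) * (min 1 (k y))⁻¹)
      volume :=
    AEStronglyMeasurable.mul hv.aestronglyMeasurable hm.inv.aestronglyMeasurable
  refine h1.congr ?_
  filter_upwards [ae_ne_zero' (E := E)] with y hy
  have := hk.p_pos hy
  field_simp

theorem KerHyp.xi_int {k : E → ℝ} (hk : KerHyp k) {ξ : E → ℝ} (hξ : Integrable ξ) :
    Integrable (fun x => ξ x * min 1 (k x)) := by
  have hm : AEMeasurable (fun x => min 1 (k x)) volume :=
    aemeasurable_const.min hk.meas.aemeasurable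
  refine Integrable.mono' hξ.norm (hξ.aestronglyMeasurable.mul hm.aestronglyMeasurable) ?_
  filter_upwards [ae_ne_zero' (E := E)] with y hy
  have h1 := hk.p_pos hy
  rw [norm_mul, Real.norm_of_nonneg h1.le]
  exact mul_le_of_le_one_right (norm_nonneg _) (min_le_left _ _)

theorem KerHyp.ae_add {x : E} : ∀ᵐ y : E, x + y ≠ 0 := by
  have h0 : (𝓝[≠] (0 : E)).NeBot := Module.punctured_nhds_neBot ℝ E 0
  have : ∀ᵐ y : E, y ≠ -x := Measure.ae_ne volume (-x)
  filter_upwards [this] with y hy h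
  exact hy (eq_neg_of_add_eq_zero_right h)

/-- Uniform integrability of `v (x + y) k y` away from the origin. -/
theorem KerHyp.shift {k : E → ℝ} (hk : KerHyp k) {v : E → ℝ}
    (hv : Integrable (fun x => v x * min 1 (k x))) (R : ℝ) {r : ℝ} (hr : 0 < r) :
    ∃ B, ∀ x, ‖x‖ ≤ R → IntegrableOn (fun y => v (x + y) * k y) {y : E | r < ‖y‖} ∧
      |∫ y in {y : E | r < ‖y‖}, v (x + y) * k y| ≤ B := by
  obtain ⟨C, hC, h⟩ := hk.f1 R r hr
  refine ⟨∫ x, C * ‖v x * min 1 (k x)‖, fun x hx => ?_⟩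
  have hs : Integrable (fun y => C * ‖v (x + y) * min 1 (k (x + y))‖) :=
    (hv.norm.const_mul C).comp_add_left x
  have hle : ∀ᵐ y ∂(volume.restrict {y : E | r < ‖y‖}), ‖v (x + y) * k y‖ ≤
      C * ‖v (x + y) * min 1 (k (x + y))‖ := by
    refine (ae_restrict_iff' (meas_gt r)).2 ?_
    filter_upwards [KerHyp.ae_add (x := x)] with y hxy hy
    have hy' : r < ‖y‖ := hy
    have hk0 : 0 < k y := hk.nonneg y (norm_pos_iff.1 (hr.trans hy'))
    rw [norm_mul, norm_mul, Real.norm_of_nonneg hk0.le, Real.norm_of_nonneg (hk.p_pos hxy).le]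
    have := h x y hx hy'.le hxy
    calc ‖v (x + y)‖ * k y ≤ ‖v (x + y)‖ * (C * min 1 (k (x + y))) := by gcongr
      _ = _ := by ring
  have hvm : AEStronglyMeasurable (fun y => v (x + y)) volume :=
    (hk.v_meas hv).comp_measurePreserving (measurePreserving_add_left volume x)
  have hI : IntegrableOn (fun y => v (x + y) * k y) {y : E | r < ‖y‖} :=
    Integrable.mono' hs.integrableOn (hvm.mul hk.meas).restrict hle
  refine ⟨hI, ?_⟩
  rw [← Real.norm_eq_abs]
  calc ‖∫ y in {y : E | r < ‖y‖}, v (x + y) * k y‖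
      ≤ ∫ y in {y : E | r < ‖y‖}, C * ‖v (x + y) * min 1 (k (x + y))‖ :=
        norm_integral_le_of_norm_le hs.integrableOn hle
    _ ≤ ∫ y, C * ‖v (x + y) * min 1 (k (x + y))‖ :=
        setIntegral_le_integral hs (Eventually.of_forall fun y => by positivity)
    _ = ∫ x, C * ‖v x * min 1 (k x)‖ :=
        integral_add_left_eq_self (fun x => C * ‖v x * min 1 (k x)‖) x

theorem KerHyp.diff_int {k : E → ℝ} (hk : KerHyp k) {v : E → ℝ}
    (hv : Integrable (fun x => v x * min 1 (k x))) (x : E) {r : ℝ} (hr : 0 < r) :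
    IntegrableOn (fun y => (v (x + y) - v x) * k y) {y : E | r < ‖y‖} ∧
    TL k v x r = (∫ y in {y : E | r < ‖y‖}, v (x + y) * k y)
      - v x * ∫ y in {y : E | r < ‖y‖}, k y := by
  obtain ⟨B, hB⟩ := hk.shift hv ‖x‖ hr
  obtain ⟨h1, -⟩ := hB x le_rfl
  have h2 := (hk.intOn hr).const_mul (v x)
  constructor
  · refine (h1.sub h2).congr (Eventually.of_forall fun y => ?_)
    simp [sub_mul]
  · unfold TL
    simp_rw [sub_mul]
    rw [integral_sub h1 h2, integral_const_mul]

/-- The principal value exists, with a bound, once second differences are quadratic. -/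
theorem KerHyp.pv {k : E → ℝ} (hk : KerHyp k) {w : E → ℝ}
    (hw : Integrable (fun x => w x * min 1 (k x))) (x : E) {r₀ M : ℝ} (hr₀ : 0 < r₀)
    (hr₁ : r₀ ≤ 1)
    (hM : ∀ y, ‖y‖ ≤ r₀ → |w (x + y) + w (x - y) - 2 * w x| ≤ M * ‖y‖ ^ 2) :
    (∃ ℓ, Tendsto (TL k w x) (𝓝[>] 0) (𝓝 ℓ)) ∧
    ∀ r, 0 < r → r ≤ r₀ → |TL k w x r| ≤
      |TL k w x r₀| + 1 / 2 * ∫ y, M * (min 1 (‖y‖ ^ 2) * k y) := by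
  set A : ℝ → Set E := fun r => {y | r < ‖y‖ ∧ ‖y‖ ≤ r₀} with hA
  have hAm : ∀ r, MeasurableSet (A r) := fun r =>
    (meas_gt r).inter (measurableSet_le measurable_norm measurable_const)
  set S : E → ℝ := fun y => (w (x + y) + w (x - y) - 2 * w x) * k y with hS
  have hSm : AEStronglyMeasurable S volume := by
    have h1 : AEStronglyMeasurable (fun y => w (x + y)) volume :=
      (hk.v_meas hw).comp_measurePreserving (measurePreserving_add_left volume x)
    have h2 : AEStronglyMeasurable (fun y => w (x - y)) volume :=
      (hk.v_meas hw).comp_quasiMeasurePreserving (quasiMeasurePreserving_sub_left volume x)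
    exact ((h1.add h2).sub aestronglyMeasurable_const).mul hk.meas
  have hbd : ∀ r, 0 ≤ r → ∀ᵐ y : E, ‖(A r).indicator S y‖ ≤ M * (min 1 (‖y‖ ^ 2) * k y) := by
    intro r hr
    have hM0 : 0 ≤ M := by
      obtain ⟨y, hy⟩ := exists_norm_eq E hr₀.le
      have := (abs_nonneg _).trans (hM y hy.le)
      rw [hy] at this
      have h2 : 0 < r₀ ^ 2 := by positivity
      by_contra hneg
      push Not at hneg
      nlinarith
    filter_upwards [ae_ne_zero' (E := E)] with y hy
    have hk0 := hk.nonneg y hy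
    by_cases hyA : y ∈ A r
    · rw [indicator_of_mem hyA, hS, norm_mul, Real.norm_of_nonneg hk0.le, ← mul_assoc]
      have : min 1 (‖y‖ ^ 2) = ‖y‖ ^ 2 :=
        min_eq_right (pow_le_one₀ (norm_nonneg _) (hyA.2.trans hr₁))
      rw [this]
      gcongr
      exact hM y hyA.2
    · rw [indicator_of_notMem hyA, norm_zero]
      have : 0 ≤ min 1 (‖y‖ ^ 2) := le_min zero_le_one (by positivity)
      positivity
  have key : ∀ r, 0 < r → r ≤ r₀ →
      TL k w x r = TL k w x r₀ + 1 / 2 * ∫ y, (A r).indicator S y := by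
    intro r hr hrr
    have hD := (hk.diff_int hw x hr).1
    have hsub : A r ⊆ {y : E | r < ‖y‖} := fun y hy => hy.1
    have hsub2 : {y : E | r₀ < ‖y‖} ⊆ {y : E | r < ‖y‖} := fun y hy => lt_of_le_of_lt hrr hy
    have hun : {y : E | r < ‖y‖} = A r ∪ {y : E | r₀ < ‖y‖} := by
      ext y
      simp only [hA, mem_ofPred_eq, mem_union]
      constructor
      · intro h
        rcases le_or_gt ‖y‖ r₀ with h' | h'
        · exact Or.inl ⟨h, h'⟩
        · exact Or.inr h'
      · rintro (h | h)
        · exact h.1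
        · exact hrr.trans_lt h
    have hdisj : Disjoint (A r) {y : E | r₀ < ‖y‖} := by
      rw [Set.disjoint_left]
      intro y hy hy'
      exact absurd hy.2 (not_le.2 hy')
    have hsplit : TL k w x r = (∫ y in A r, (w (x + y) - w x) * k y) + TL k w x r₀ := by
      unfold TL
      conv_lhs => rw [hun]
      exact setIntegral_union hdisj (meas_gt r₀) (hD.mono_set hsub) (hD.mono_set hsub2)
    have hDA : Integrable ((A r).indicator fun y => (w (x + y) - w x) * k y) :=
      (integrable_indicator_iff (hAm r)).2 (hD.mono_set hsub)
    have hneg : (∫ y, (A r).indicator (fun y => (w (x + y) - w x) * k y) (-y)) =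
        ∫ y, (A r).indicator (fun y => (w (x + y) - w x) * k y) y :=
      integral_neg_eq_self _ volume
    have hsum : ∀ y, (A r).indicator S y = (A r).indicator (fun y => (w (x + y) - w x) * k y) y
        + (A r).indicator (fun y => (w (x + y) - w x) * k y) (-y) := by
      intro y
      by_cases hy : y ∈ A r
      · have hy' : -y ∈ A r := by simpa [hA] using hy
        rw [indicator_of_mem hy, indicator_of_mem hy, indicator_of_mem hy']
        simp only [hS, hk.even, sub_eq_add_neg x y]
        ring
      · have hy' : -y ∉ A r := by simpa [hA] using hy
        rw [indicator_of_notMem hy, indicator_of_notMem hy, indicator_of_notMem hy', add_zero]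
    simp_rw [hsum]
    rw [integral_add hDA hDA.comp_neg, hneg, hsplit, integral_indicator (hAm r)]
    ring
  constructor
  · refine ⟨TL k w x r₀ + 1 / 2 * ∫ y, (A 0).indicator S y, ?_⟩
    have hlim : Tendsto (fun r => ∫ y, (A r).indicator S y) (𝓝[>] 0)
        (𝓝 (∫ y, (A 0).indicator S y)) := by
      refine tendsto_integral_filter_of_dominated_convergence
        (fun y => M * (min 1 (‖y‖ ^ 2) * k y)) (Eventually.of_forall fun r => hSm.indicator (hAm r))
        ?_ (hk.int.const_mul M) ?_
      · filter_upwards [self_mem_nhdsWithin] with r hr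
        exact hbd r (le_of_lt hr)
      · filter_upwards [ae_ne_zero' (E := E)] with y hy
        refine tendsto_const_nhds.congr' ?_
        have : ∀ᶠ r in 𝓝[>] (0:ℝ), r < ‖y‖ :=
          nhdsWithin_le_nhds (eventually_lt_nhds (norm_pos_iff.2 hy))
        filter_upwards [this] with r hr
        by_cases h : ‖y‖ ≤ r₀
        · rw [indicator_of_mem, indicator_of_mem]
          · exact ⟨hr, h⟩
          · exact ⟨norm_pos_iff.2 hy, h⟩
        · rw [indicator_of_notMem, indicator_of_notMem]
          · exact fun h' => h h'.2
          · exact fun h' => h h'.2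
    refine (tendsto_const_nhds.add (hlim.const_mul (1 / 2))).congr' ?_
    have : ∀ᶠ r in 𝓝[>] (0:ℝ), r < r₀ := nhdsWithin_le_nhds (eventually_lt_nhds hr₀)
    filter_upwards [self_mem_nhdsWithin, this] with r hr hr'
    exact (key r hr hr'.le).symm
  · intro r hr hrr
    rw [key r hr hrr]
    refine (abs_add_le _ _).trans ?_
    rw [abs_mul, abs_of_pos (by norm_num : (0:ℝ) < 1 / 2)]
    gcongr
    rw [← Real.norm_eq_abs]
    exact norm_integral_le_of_norm_le (hk.int.const_mul M) (hbd r hr.le)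

/-- Uniform quadratic bound of second differences of a `C²` function. -/
theorem second_diff_s1 {w : E → ℝ} {W K : Set E} (hW : IsOpen W) (hw : ContDiffOn ℝ 2 w W)
    (hK : IsCompact K) {r₀ : ℝ} (hKW : Metric.cthickening r₀ K ⊆ W) :
    ∃ M, ∀ x ∈ K, ∀ y, ‖y‖ ≤ r₀ → |w (x + y) + w (x - y) - 2 * w x| ≤ M * ‖y‖ ^ 2 := by
  have hproper : ProperSpace E := FiniteDimensional.proper ℝ E
  have h1 : ContDiffOn ℝ 1 (fderiv ℝ w) W := hw.fderiv_of_isOpen hW (by norm_num)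
  have h2 : ContinuousOn (fderiv ℝ (fderiv ℝ w)) W :=
    h1.continuousOn_fderiv_of_isOpen hW (by norm_num)
  obtain ⟨M, hM⟩ := (hK.cthickening (r := r₀)).exists_bound_of_continuousOn
    (f := fderiv ℝ (fderiv ℝ w)) (h2.mono hKW)
  refine ⟨2 * M, fun x hx y hy => ?_⟩
  have hball : Metric.closedBall x ‖y‖ ⊆ Metric.cthickening r₀ K :=
    (Metric.closedBall_subset_closedBall hy).trans (Metric.closedBall_subset_cthickening hx r₀)
  have hM0 : 0 ≤ M := (norm_nonneg _).trans (hM x (hball (by simp)))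
  have hd1 : ∀ z ∈ Metric.closedBall x ‖y‖, DifferentiableAt ℝ (fderiv ℝ w) z := fun z hz =>
    (h1.differentiableOn (by norm_num)).differentiableAt (hW.mem_nhds (hKW (hball hz)))
  have hd0 : ∀ z ∈ Metric.closedBall x ‖y‖, DifferentiableAt ℝ w z := fun z hz =>
    (hw.differentiableOn (by norm_num)).differentiableAt (hW.mem_nhds (hKW (hball hz)))
  have hxm : x ∈ Metric.closedBall x ‖y‖ := by simp
  have hlip : ∀ z ∈ Metric.closedBall x ‖y‖, ‖fderiv ℝ w z - fderiv ℝ w x‖ ≤ M * ‖y‖ := by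
    intro z hz
    have := (convex_closedBall x ‖y‖).norm_image_sub_le_of_norm_fderiv_le hd1
      (fun u hu => hM u (hball hu)) hxm hz
    refine this.trans ?_
    gcongr
    simpa [dist_eq_norm] using hz
  have htay : ∀ z ∈ Metric.closedBall x ‖y‖,
      ‖w z - w x - fderiv ℝ w x (z - x)‖ ≤ M * ‖y‖ * ‖y‖ := by
    intro z hz
    have := (convex_closedBall x ‖y‖).norm_image_sub_le_of_norm_fderiv_le' hd0 hlip hxm hz
    refine this.trans ?_
    gcongr
    simpa [dist_eq_norm] using hz
  have ha := htay (x + y) (by simp)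
  have hb := htay (x - y) (by simp)
  have e : w (x + y) + w (x - y) - 2 * w x = (w (x + y) - w x - fderiv ℝ w x (x + y - x))
      + (w (x - y) - w x - fderiv ℝ w x (x - y - x)) := by
    have e1 : x + y - x = y := by abel
    have e2 : x - y - x = -y := by abel
    rw [e1, e2, map_neg]
    ring
  rw [e, ← Real.norm_eq_abs]
  refine (norm_add_le _ _).trans ?_
  nlinarith

/-- Symmetry of the truncated form. -/
theorem KerHyp.fubini {k : E → ℝ} (hk : KerHyp k) {v ξ : E → ℝ} {R Q : ℝ}
    (hv : Integrable (fun x => v x * min 1 (k x))) (hξ : Integrable ξ)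
    (hR : ∀ z, ξ z ≠ 0 → ‖z‖ ≤ R) (hQ : ∀ z, |ξ z| ≤ Q) {r : ℝ} (hr : 0 < r) :
    Integrable (fun x => v x * TL k ξ x r) ∧ Integrable (fun x => ξ x * TL k v x r) ∧
    ∫ x, v x * TL k ξ x r = ∫ x, ξ x * TL k v x r := by
  set kr : E → ℝ := {y : E | r < ‖y‖}.indicator k with hkr
  have hkrm : AEStronglyMeasurable kr volume := hk.meas.indicator (meas_gt r)
  have hkre : ∀ y, kr (-y) = kr y := by
    intro y
    by_cases hy : r < ‖y‖
    · rw [hkr, indicator_of_mem (by simpa using hy), indicator_of_mem (by simpa using hy),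
        hk.even]
    · rw [hkr, indicator_of_notMem (by simpa using hy), indicator_of_notMem (by simpa using hy)]
  have hvm := hk.v_meas hv
  have hconv : ∀ (f : E → ℝ) (x : E), (∫ y in {y : E | r < ‖y‖}, f (x + y) * k y) =
      ∫ z, f z * kr (z - x) := by
    intro f x
    rw [← integral_add_left_eq_self (fun z => f z * kr (z - x)) x, ← integral_indicator (meas_gt r)]
    congr 1
    ext y
    rw [add_sub_cancel_left]
    by_cases hy : y ∈ {y : E | r < ‖y‖}
    · rw [indicator_of_mem hy, hkr, indicator_of_mem hy]
    · rw [indicator_of_notMem hy, hkr, indicator_of_notMem hy, mul_zero]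
  obtain ⟨C, hC, hf1⟩ := hk.f1 R r hr
  obtain ⟨C2, hC2, hf2⟩ := hk.f2 R
  have hP : Integrable (fun p : E × E => v p.1 * ξ p.2 * kr (p.2 - p.1))
      (volume.prod volume) := by
    have hb : Integrable (fun p : E × E => C * ((v p.1 * min 1 (k p.1)) * ξ p.2))
      (volume.prod volume) := (hv.mul_prod hξ).const_mul C
    refine Integrable.mono' hb.norm ?_ ?_
    · refine (hvm.comp_fst.mul hξ.aestronglyMeasurable.comp_snd).mul ?_
      have hq : Measure.QuasiMeasurePreserving (fun p : E × E => p.1 - p.2)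
        (volume.prod volume) volume := quasiMeasurePreserving_sub volume volume
      have h3 := hkrm.comp_quasiMeasurePreserving hq
      refine h3.congr (Eventually.of_forall fun p => ?_)
      simp only [Function.comp]
      rw [← hkre, neg_sub]
    · have h0 : ∀ᵐ p : E × E ∂(volume.prod volume), p.1 ≠ 0 :=
        Measure.quasiMeasurePreserving_fst.ae ae_ne_zero'
      filter_upwards [h0] with p hp
      by_cases hz : ξ p.2 = 0
      · simp [hz]
      by_cases hy : r < ‖p.2 - p.1‖
      · rw [hkr, indicator_of_mem (by simpa using hy)]
        have hk0 := hk.nonneg (p.2 - p.1) (norm_pos_iff.1 (hr.trans hy))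
        have h5 := hf1 p.2 (p.1 - p.2) (hR _ hz) (by rw [norm_sub_rev]; exact hy.le)
          (by simpa using hp)
        rw [add_sub_cancel, ← hk.even, neg_sub] at h5
        have h6 := hk.p_pos hp
        rw [norm_mul, norm_mul, norm_mul, norm_mul, norm_mul, Real.norm_of_nonneg hk0.le,
          Real.norm_of_nonneg hC, Real.norm_of_nonneg h6.le]
        calc ‖v p.1‖ * ‖ξ p.2‖ * k (p.2 - p.1)
            ≤ ‖v p.1‖ * ‖ξ p.2‖ * (C * min 1 (k p.1)) := by gcongr
          _ = _ := by ring
      · rw [hkr, indicator_of_notMem (by simpa using hy), mul_zero, norm_zero]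
        exact norm_nonneg _
  have hvξ : Integrable (fun x => v x * ξ x) := by
    refine Integrable.mono' (hv.norm.const_mul (Q * C2)) (hvm.mul hξ.aestronglyMeasurable) ?_
    filter_upwards [ae_ne_zero' (E := E)] with x hx
    by_cases hz : ξ x = 0
    · have hQ0 : 0 ≤ Q := (abs_nonneg _).trans (hQ x)
      simp only [hz, mul_zero, norm_zero]
      positivity
    have h6 := hk.p_pos hx
    have h7 := hf2 x (hR x hz) hx
    have h8 := hQ x
    have hQ0 : 0 ≤ Q := (abs_nonneg _).trans h8
    rw [norm_mul, norm_mul, Real.norm_of_nonneg h6.le, Real.norm_eq_abs (ξ x)]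
    calc ‖v x‖ * |ξ x| ≤ ‖v x‖ * Q * 1 := by rw [mul_one]; gcongr
      _ ≤ ‖v x‖ * Q * (C2 * min 1 (k x)) := by gcongr
      _ = _ := by ring
  set Λ := ∫ y in {y : E | r < ‖y‖}, k y with hΛ
  have e1 : ∀ x, v x * TL k ξ x r = (∫ z, v x * ξ z * kr (z - x)) - v x * ξ x * Λ := by
    intro x
    rw [(hk.diff_int (hk.xi_int hξ) x hr).2, hconv, mul_sub, ← integral_const_mul]
    simp_rw [mul_assoc]
    rfl
  have e2 : ∀ z, ξ z * TL k v z r = (∫ x, v x * ξ z * kr (z - x)) - v z * ξ z * Λ := by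
    intro z
    rw [(hk.diff_int hv z hr).2, hconv, mul_sub, ← integral_const_mul]
    congr 1
    · congr 1
      ext x
      rw [← hkre (z - x), neg_sub]
      ring
    · ring
  have i1 := hP.integral_prod_left
  have i2 := hP.integral_prod_right
  have i3 := hvξ.mul_const Λ
  simp_rw [e1, e2]
  refine ⟨i1.sub i3, i2.sub i3, ?_⟩
  rw [integral_sub i1 i3, integral_sub i2 i3]
  congr 1
  exact integral_integral_swap (f := fun x z => v x * ξ z * kr (z - x)) hP

/-- Uniform bound for the truncated operator on compact sets. -/
theorem KerHyp.unif {k : E → ℝ} (hk : KerHyp k) {w : E → ℝ}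
    (hw : Integrable (fun x => w x * min 1 (k x))) {W K : Set E} (hW : IsOpen W)
    (hwC : ContDiffOn ℝ 2 w W) (hK : IsCompact K) {r₀ : ℝ} (hr₀ : 0 < r₀) (hr₁ : r₀ ≤ 1)
    (hKW : Metric.cthickening r₀ K ⊆ W) :
    (∀ x ∈ K, ∃ ℓ, Tendsto (TL k w x) (𝓝[>] 0) (𝓝 ℓ)) ∧
    ∃ B, ∀ x ∈ K, ∀ r, 0 < r → r ≤ r₀ → |TL k w x r| ≤ B := by
  obtain ⟨M, hM⟩ := second_diff_s1 hW hwC hK hKW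
  have hpv := fun x (hx : x ∈ K) => hk.pv hw x hr₀ hr₁ (hM x hx)
  refine ⟨fun x hx => (hpv x hx).1, ?_⟩
  obtain ⟨R, hR⟩ := hK.isBounded.exists_norm_le
  obtain ⟨B, hB⟩ := hk.shift hw R hr₀
  obtain ⟨Q, hQ⟩ := hK.exists_bound_of_continuousOn
    (hwC.continuousOn.mono ((Metric.self_subset_cthickening K).trans hKW))
  refine ⟨B + Q * |∫ y in {y : E | r₀ < ‖y‖}, k y|
    + 1 / 2 * ∫ y, M * (min 1 (‖y‖ ^ 2) * k y), fun x hx r hr hrr => ?_⟩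
  refine ((hpv x hx).2 r hr hrr).trans ?_
  gcongr
  rw [(hk.diff_int hw x hr₀).2]
  refine (abs_sub _ _).trans ?_
  rw [abs_mul]
  gcongr
  · exact (hB x (hR x hx)).2
  · exact hQ x hx

theorem KerHyp.test_bound {k : E → ℝ} (hk : KerHyp k) {ξ : E → ℝ} (hξ : ContDiff ℝ 2 ξ)
    (hcs : HasCompactSupport ξ) :
    ∃ C, ∀ x, x ≠ 0 → ∀ r, 0 < r → r ≤ 1 → |TL k ξ x r| ≤ C * min 1 (k x) := by
  have hproper : ProperSpace E := FiniteDimensional.proper ℝ E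
  have hξi : Integrable ξ := hξ.continuous.integrable_of_hasCompactSupport hcs
  obtain ⟨R, hR⟩ := hcs.isCompact.isBounded.exists_norm_le
  have hR' : ∀ z, ξ z ≠ 0 → ‖z‖ ≤ R := fun z hz => hR z (subset_tsupport _ hz)
  obtain ⟨-, B, hB⟩ := hk.unif (hk.xi_int hξi) isOpen_univ hξ.contDiffOn
    (isCompact_closedBall (0 : E) (R + 1)) one_pos le_rfl (subset_univ _)
  obtain ⟨C1, hC1, hf1⟩ := hk.f1 R 1 one_pos
  obtain ⟨C2, hC2, hf2⟩ := hk.f2 (R + 1)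
  refine ⟨max (C1 * ∫ z, ‖ξ z‖) (|B| * C2), fun x hx r hr hr1 => ?_⟩
  have hp := hk.p_pos hx
  by_cases hxR : ‖x‖ ≤ R + 1
  · calc |TL k ξ x r| ≤ B := hB x (by simpa using hxR) r hr hr1
      _ ≤ |B| * 1 := by rw [mul_one]; exact le_abs_self B
      _ ≤ |B| * (C2 * min 1 (k x)) := by gcongr; exact hf2 x hxR hx
      _ = |B| * C2 * min 1 (k x) := by ring
      _ ≤ _ := by gcongr; exact le_max_right _ _
  · push Not at hxR
    have hξx : ξ x = 0 := by
      by_contra h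
      linarith [hR' x h]
    have hle : ‖TL k ξ x r‖ ≤ ∫ y in {y : E | r < ‖y‖}, (C1 * min 1 (k x)) * ‖ξ (x + y)‖ := by
      refine norm_integral_le_of_norm_le (((hξi.norm).comp_add_left x).const_mul _).integrableOn ?_
      refine (ae_restrict_iff' (meas_gt r)).2 (Eventually.of_forall fun y hy => ?_)
      have hy' : r < ‖y‖ := hy
      have hk0 := hk.nonneg y (norm_pos_iff.1 (hr.trans hy'))
      rw [hξx, sub_zero]
      by_cases hz : ξ (x + y) = 0
      · simp [hz]
      have hn := hR' _ hz
      have hy1 : 1 ≤ ‖y‖ := by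
        have : ‖x‖ ≤ ‖x + y‖ + ‖y‖ := by
          have := norm_sub_le (x + y) y
          rwa [add_sub_cancel_right] at this
        linarith
      have h5 := hf1 (x + y) (-y) hn (by rwa [norm_neg]) (by simpa using hx)
      rw [add_neg_cancel_right, hk.even] at h5
      rw [norm_mul, Real.norm_of_nonneg hk0.le, mul_comm]
      gcongr
    rw [← Real.norm_eq_abs]
    calc ‖TL k ξ x r‖ ≤ ∫ y in {y : E | r < ‖y‖}, (C1 * min 1 (k x)) * ‖ξ (x + y)‖ := hle
      _ ≤ ∫ y, (C1 * min 1 (k x)) * ‖ξ (x + y)‖ :=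
        setIntegral_le_integral (((hξi.norm).comp_add_left x).const_mul _)
          (Eventually.of_forall fun y => by positivity)
      _ = (C1 * ∫ z, ‖ξ z‖) * min 1 (k x) := by
        rw [integral_const_mul, integral_add_left_eq_self (fun z => ‖ξ z‖) x]
        ring
      _ ≤ _ := by gcongr; exact le_max_left _ _

theorem KerHyp.main {k : E → ℝ} (hk : KerHyp k) {v ξ Lv Lξ : E → ℝ}
    (hv : Integrable (fun x => v x * min 1 (k x))) (hξ : ContDiff ℝ 2 ξ)
    (hcs : HasCompactSupport ξ) {W : Set E} (hW : IsOpen W) (hvC : ContDiffOn ℝ 2 v W)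
    {r₀ : ℝ} (hr₀ : 0 < r₀) (hr₁ : r₀ ≤ 1) (hKW : Metric.cthickening r₀ (tsupport ξ) ⊆ W)
    (hLξ : ∀ x, Tendsto (TL k ξ x) (𝓝[>] 0) (𝓝 (Lξ x)))
    (hLv : ∀ x ∈ tsupport ξ, Tendsto (TL k v x) (𝓝[>] 0) (𝓝 (Lv x))) :
    Integrable (fun x => v x * Lξ x) ∧ Integrable (fun x => ξ x * Lv x) ∧
    ∫ x, v x * Lξ x = ∫ x, ξ x * Lv x := by
  have hproper : ProperSpace E := FiniteDimensional.proper ℝ E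
  have hξi : Integrable ξ := hξ.continuous.integrable_of_hasCompactSupport hcs
  obtain ⟨R, hR⟩ := hcs.isCompact.isBounded.exists_norm_le
  have hR' : ∀ z, ξ z ≠ 0 → ‖z‖ ≤ R := fun z hz => hR z (subset_tsupport _ hz)
  obtain ⟨Q, hQ⟩ := hcs.exists_bound_of_continuous hξ.continuous
  obtain ⟨C, hC⟩ := hk.test_bound hξ hcs
  obtain ⟨-, B, hB⟩ := hk.unif hv hW hvC hcs.isCompact hr₀ hr₁ hKW
  have hF := fun r (hr : 0 < r) => hk.fubini hv hξi hR' hQ hr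
  have hsm : ∀ᶠ r in 𝓝[>] (0:ℝ), 0 < r ∧ r ≤ r₀ := by
    have : ∀ᶠ r in 𝓝[>] (0:ℝ), r < r₀ := nhdsWithin_le_nhds (eventually_lt_nhds hr₀)
    filter_upwards [self_mem_nhdsWithin, this] with r hr hr'
    exact ⟨hr, hr'.le⟩
  have bi1 : Integrable (fun x => C * ‖v x * min 1 (k x)‖) := hv.norm.const_mul C
  have bi2 : Integrable (fun x => ‖ξ x‖ * B) := hξi.norm.mul_const B
  have b1 : ∀ᶠ r in 𝓝[>] (0:ℝ), ∀ᵐ x : E, ‖v x * TL k ξ x r‖ ≤ C * ‖v x * min 1 (k x)‖ := by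
    filter_upwards [hsm] with r hr
    filter_upwards [ae_ne_zero' (E := E)] with x hx
    have hp := hk.p_pos hx
    rw [norm_mul, norm_mul, Real.norm_of_nonneg hp.le]
    calc ‖v x‖ * ‖TL k ξ x r‖ ≤ ‖v x‖ * (C * min 1 (k x)) := by
          gcongr
          exact hC x hx r hr.1 (hr.2.trans hr₁)
      _ = _ := by ring
  have b2 : ∀ᶠ r in 𝓝[>] (0:ℝ), ∀ᵐ x : E, ‖ξ x * TL k v x r‖ ≤ ‖ξ x‖ * B := by
    filter_upwards [hsm] with r hr
    refine Eventually.of_forall fun x => ?_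
    by_cases hz : ξ x = 0
    · simp [hz]
    rw [norm_mul]
    gcongr
    exact hB x (subset_tsupport _ hz) r hr.1 hr.2
  have l1 : ∀ x, Tendsto (fun r => v x * TL k ξ x r) (𝓝[>] 0) (𝓝 (v x * Lξ x)) :=
    fun x => (hLξ x).const_mul _
  have l2 : ∀ x, Tendsto (fun r => ξ x * TL k v x r) (𝓝[>] 0) (𝓝 (ξ x * Lv x)) := by
    intro x
    by_cases hz : ξ x = 0
    · simp [hz]
    exact (hLv x (subset_tsupport _ hz)).const_mul _
  have gen : ∀ (F : E → ℝ → ℝ) (f g : E → ℝ), Integrable g →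
      (∀ r, 0 < r → Integrable (fun x => F x r)) →
      (∀ᶠ r in 𝓝[>] (0:ℝ), ∀ᵐ x : E, ‖F x r‖ ≤ g x) →
      (∀ x, Tendsto (F x) (𝓝[>] 0) (𝓝 (f x))) →
      Integrable f ∧ Tendsto (fun r => ∫ x, F x r) (𝓝[>] 0) (𝓝 (∫ x, f x)) := by
    intro F f g hg hFi hFg hFf
    have hmeas : ∀ᶠ r in 𝓝[>] (0:ℝ), AEStronglyMeasurable (fun x => F x r) volume := by
      filter_upwards [self_mem_nhdsWithin] with r hr
      exact (hFi r hr).aestronglyMeasurable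
    refine ⟨?_, tendsto_integral_filter_of_dominated_convergence g hmeas hFg hg
      (Eventually.of_forall hFf)⟩
    obtain ⟨u, hu⟩ := exists_seq_tendsto (𝓝[>] (0:ℝ))
    obtain ⟨N, hN⟩ := eventually_atTop.1 (hu.eventually (hmeas.and hFg))
    have hu' : Tendsto (fun n => u (n + N)) atTop (𝓝[>] (0:ℝ)) :=
      hu.comp (tendsto_add_atTop_nat N)
    refine Integrable.mono' hg (aestronglyMeasurable_of_tendsto_ae atTop
      (fun n => (hN (n + N) (by omega)).1)
      (Eventually.of_forall fun x => (hFf x).comp hu')) ?_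
    have := ae_all_iff.2 (fun n : ℕ => (hN (n + N) (by omega)).2)
    filter_upwards [this] with x hx
    exact le_of_tendsto ((hFf x).comp hu').norm (Eventually.of_forall hx)
  obtain ⟨I1, T1⟩ := gen _ _ _ bi1 (fun r hr => (hF r hr).1) b1 l1
  obtain ⟨I2, T2⟩ := gen _ _ _ bi2 (fun r hr => (hF r hr).2.1) b2 l2
  refine ⟨I1, I2, tendsto_nhds_unique T1 (T2.congr' ?_)⟩
  filter_upwards [self_mem_nhdsWithin] with r hr
  exact (hF r hr).2.2.symm

end Helpers

theorem kerHyp_of {d : ℕ} (hd : 2 ≤ d)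
    {j : ℝ → ℝ} (hjpos : ∀ r > 0, 0 < j r) (hjanti : AntitoneOn j (Set.Ioi 0))
    (hjint : Integrable (fun y : EuclideanSpace ℝ (Fin d) => min 1 (‖y‖ ^ 2) * j ‖y‖))
    {κ : ℝ} (hκ : 1 ≤ κ) (hjdoub : ∀ r > 0, j r ≤ κ * j (2 * r)) :
    KerHyp (fun y : EuclideanSpace ℝ (Fin d) => j ‖y‖) := by
  have hiter : ∀ n : ℕ, ∀ r > 0, j r ≤ κ ^ n * j (2 ^ n * r) := by
    intro n
    induction n with
    | zero => intro r hr; simp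
    | succ n ih =>
      intro r hr
      calc j r ≤ κ ^ n * j (2 ^ n * r) := ih r hr
        _ ≤ κ ^ n * (κ * j (2 * (2 ^ n * r))) := by
          gcongr
          exact hjdoub _ (by positivity)
        _ = κ ^ (n + 1) * j (2 ^ (n + 1) * r) := by
          rw [pow_succ, pow_succ, mul_assoc]
          congr 3
          ring
  refine ⟨fun y => by simp, fun y hy => hjpos _ (norm_pos_iff.2 hy), hjint, ?_, ?_⟩
  · intro R r hr
    obtain ⟨n, hn⟩ := pow_unbounded_of_one_lt (1 + |R| / r) (one_lt_two : (1:ℝ) < 2)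
    have hjr := hjpos r hr
    refine ⟨max (j r) (κ ^ n), le_max_of_le_left hjr.le, fun x y hx hy hxy => ?_⟩
    have hy0 : 0 < ‖y‖ := hr.trans_le hy
    have hxy0 : 0 < ‖x + y‖ := norm_pos_iff.2 hxy
    have hj2 := hjpos _ hxy0
    show j ‖y‖ ≤ _
    rcases min_choice 1 (j ‖x + y‖) with h | h
    · rw [h, mul_one]
      exact (hjanti hr hy0 hy).trans (le_max_left _ _)
    · rw [h]
      have hle : ‖x + y‖ ≤ 2 ^ n * ‖y‖ := by
        calc ‖x + y‖ ≤ ‖x‖ + ‖y‖ := norm_add_le _ _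
          _ ≤ |R| + ‖y‖ := by gcongr; exact hx.trans (le_abs_self R)
          _ = |R| / r * r + ‖y‖ := by rw [div_mul_cancel₀ _ hr.ne']
          _ ≤ |R| / r * ‖y‖ + ‖y‖ := by gcongr
          _ = (1 + |R| / r) * ‖y‖ := by ring
          _ ≤ 2 ^ n * ‖y‖ := by gcongr
      calc j ‖y‖ ≤ κ ^ n * j (2 ^ n * ‖y‖) := hiter n _ hy0
        _ ≤ κ ^ n * j ‖x + y‖ := by
          gcongr
          exact hjanti hxy0 (hxy0.trans_le hle) hle
        _ ≤ _ := by gcongr; exact le_max_right _ _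
  · intro R
    set R' := max R 1 with hR'
    have hR0 : 0 < R' := one_pos.trans_le (le_max_right _ _)
    have hj := hjpos R' hR0
    have hm : 0 < min 1 (j R') := lt_min one_pos hj
    refine ⟨(min 1 (j R'))⁻¹, by positivity, fun x hx hx0 => ?_⟩
    rw [inv_mul_eq_div, one_le_div hm]
    exact min_le_min_left _ (hjanti (norm_pos_iff.2 hx0) hR0 (hx.trans (le_max_left _ _)))

theorem mem_near {E : Type*} [NormedAddCommGroup E] [NormedSpace ℝ E] {Ω : Set E}
    (hΩo : IsOpen Ω) {ε₀ ε ρ : ℝ} (hε : 0 < ε) (hρ : ρ < ε₀ - ε) {x z : E}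
    (hx : x ∈ Ω ∧ ε₀ < Metric.infDist x (frontier Ω)) (hz : dist z x ≤ ρ) :
    z ∈ Ω ∧ ε < Metric.infDist z (frontier Ω) := by
  constructor
  · have hρ0 : 0 ≤ ρ := dist_nonneg.trans hz
    have hsub : Metric.closedBall x ρ ⊆ Ω := by
      have hpre : IsPreconnected (Metric.closedBall x ρ) :=
        (convex_closedBall x ρ).isPreconnected
      refine hpre.subset_left_of_subset_union hΩo isClosed_closure.isOpen_compl
        (disjoint_compl_right_iff_subset.2 subset_closure) ?_ ⟨x, by simpa using hρ0, hx.1⟩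
      intro u hu
      by_contra hcon
      simp only [mem_union, mem_compl_iff, not_or, not_not] at hcon
      have hf : u ∈ frontier Ω := by
        rw [hΩo.frontier_eq]
        exact ⟨hcon.2, hcon.1⟩
      have h1 := Metric.infDist_le_dist_of_mem (x := x) hf
      rw [dist_comm] at h1
      have h2 : dist u x ≤ ρ := hu
      linarith [hx.2]
    exact hsub hz
  · have := Metric.infDist_le_infDist_add_dist (s := frontier Ω) (x := x) (y := z)
    rw [dist_comm] at this
    linarith [hx.2]

/-- Integration by parts formula for the nonlocal operator `L`. -/
theorem integration_by_parts
    (d : ℕ) (hd : 2 ≤ d)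
    (j : ℝ → ℝ) (hjpos : ∀ r > 0, 0 < j r) (hjanti : AntitoneOn j (Set.Ioi 0))
    (hjint : Integrable (fun y : EuclideanSpace ℝ (Fin d) => min 1 (‖y‖ ^ 2) * j ‖y‖))
    (κ : ℝ) (hκ : 1 ≤ κ) (hjdoub : ∀ r > 0, j r ≤ κ * j (2 * r))
    (Ω : Set (EuclideanSpace ℝ (Fin d))) (hΩo : IsOpen Ω) (hΩb : Bornology.IsBounded Ω)
    (ε₀ ε : ℝ) (hε₀ : 0 < ε₀) (hε : 0 < ε) (hεε₀ : ε < ε₀ / 2)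
    (v : EuclideanSpace ℝ (Fin d) → ℝ)
    (hvL1 : Integrable (fun x => v x * min 1 (j ‖x‖)))
    (hvC2 : ContDiffOn ℝ 2 v {x | x ∈ Ω ∧ ε < Metric.infDist x (frontier Ω)})
    (ξ : EuclideanSpace ℝ (Fin d) → ℝ)
    (hξsm : ContDiff ℝ (⊤ : ℕ∞) ξ) (hξcs : HasCompactSupport ξ)
    (hξsupp : tsupport ξ ⊆ {x | x ∈ Ω ∧ ε₀ < Metric.infDist x (frontier Ω)})
    (Lξ : EuclideanSpace ℝ (Fin d) → ℝ)
    (hLξ : ∀ x, HasPVLim d j ξ x (Lξ x)) :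
    ∃ Lv : EuclideanSpace ℝ (Fin d) → ℝ,
      (∀ x ∈ {x | x ∈ Ω ∧ ε₀ < Metric.infDist x (frontier Ω)}, HasPVLim d j v x (Lv x)) ∧
      Integrable (fun x => v x * Lξ x) ∧
      IntegrableOn (fun x => ξ x * Lv x) {x | x ∈ Ω ∧ ε₀ < Metric.infDist x (frontier Ω)} ∧
      ∫ x, v x * Lξ x =
        ∫ x in {x | x ∈ Ω ∧ ε₀ < Metric.infDist x (frontier Ω)}, ξ x * Lv x := by
  haveI : Nonempty (Fin d) := ⟨⟨0, by omega⟩⟩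
  have hk := kerHyp_of hd hjpos hjanti hjint hκ hjdoub
  set U : Set (EuclideanSpace ℝ (Fin d)) := {x | x ∈ Ω ∧ ε₀ < Metric.infDist x (frontier Ω)}
    with hU
  set W : Set (EuclideanSpace ℝ (Fin d)) := {x | x ∈ Ω ∧ ε < Metric.infDist x (frontier Ω)}
    with hWdef
  have hW : IsOpen W :=
    hΩo.inter (isOpen_lt continuous_const (Metric.continuous_infDist_pt _))
  set r₀ : ℝ := min 1 ((ε₀ - ε) / 2) with hr₀def
  have hr₀ : 0 < r₀ := lt_min one_pos (by linarith)
  have hr₁ : r₀ ≤ 1 := min_le_left _ _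
  have hr₂ : r₀ < ε₀ - ε := (min_le_right _ _).trans_lt (by linarith)
  have hthick : ∀ K : Set (EuclideanSpace ℝ (Fin d)), IsCompact K → K ⊆ U →
      Metric.cthickening r₀ K ⊆ W := by
    intro K hK hKU
    rw [hK.cthickening_eq_biUnion_closedBall hr₀.le]
    intro z hz
    simp only [mem_iUnion] at hz
    obtain ⟨x, hx, hz⟩ := hz
    exact mem_near hΩo hε hr₂ (hKU hx) hz
  have hex : ∀ x, ∃ ℓ, x ∈ U → HasPVLim d j v x ℓ := by
    intro x
    by_cases hx : x ∈ U
    · obtain ⟨ℓ, hℓ⟩ := (hk.unif hvL1 hW hvC2 isCompact_singleton hr₀ hr₁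
        (hthick {x} isCompact_singleton (singleton_subset_iff.2 hx))).1 x rfl
      exact ⟨ℓ, fun _ => hℓ⟩
    · exact ⟨0, fun h => absurd h hx⟩
  choose Lv hLv using hex
  obtain ⟨h1, h2, h3⟩ := hk.main (Lv := Lv) (Lξ := Lξ) hvL1
    (contDiff_infty.1 hξsm 2) hξcs hW hvC2 hr₀ hr₁
    (hthick _ hξcs.isCompact hξsupp) hLξ (fun x hx => hLv x (hξsupp hx))
  refine ⟨Lv, fun x hx => hLv x hx, h1, h2.integrableOn, ?_⟩
  rw [h3, setIntegral_eq_integral_of_forall_compl_eq_zero]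
  intro x hx
  have : ξ x = 0 := by
    by_contra h
    exact hx (hξsupp (subset_tsupport _ h))
  rw [this, zero_mul]
end
end
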